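/- Let Assumption W* or Assumption S* hold, and suppose there exists a sequence α_n ↑ 1 in [0,1) such that Assumption B̲_{{α_n}} holds and (1−α_n) m_{α_n} → w̲ as n → ∞. Then the ACOI holds: there exist a deterministic policy φ and a nonnegative measurable function u : X → ℝ such that c(x,φ(x)) + ∫_X u(y) q(dy|x,φ(x)) ≤ w̲ + u(x) for all x ∈ X. -/

import Mathlib

open MeasureTheory ProbabilityTheory Filter Topology Set
open scoped ENNReal NNReal

noncomputable section

/-- The nonnegative part of an extended real, as an element of `ℝ≥0∞`. -/
def eToENN (x : EReal) : ℝ≥0∞ := if x = ⊤ then ⊤ else ENNReal.ofReal x.toReal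

/-- Extended integral of an `EReal`-valued function: positive part minus negative part. -/
def eInt {Y : Type*} [MeasurableSpace Y] (μ : Measure Y) (f : Y → EReal) : EReal :=
  ((∫⁻ y, eToENN (f y) ∂μ : ℝ≥0∞) : EReal) - ((∫⁻ y, eToENN (-(f y)) ∂μ : ℝ≥0∞) : EReal)

/-- Extended sum of an `EReal`-valued series: positive part minus negative part. -/
def eSum (f : ℕ → EReal) : EReal :=
  ((∑' t, eToENN (f t) : ℝ≥0∞) : EReal) - ((∑' t, eToENN (-(f t)) : ℝ≥0∞) : EReal)

/-- Histories of length `t`: `(X × A) ^ t × X`. -/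
abbrev Hist (X A : Type*) (t : ℕ) := (Fin t → X × A) × X

/-- A (randomized, history-dependent) policy: a regular transition probability from
histories to actions, at every time epoch. -/
structure Policy (X A : Type*) [MeasurableSpace X] [MeasurableSpace A] where
  π : ∀ t : ℕ, Kernel (Hist X A t) A
  markov : ∀ t, IsMarkovKernel (π t)

/-- A Markov decision process with state space `X`, action space `A`, one-step cost `c`
(measurable and bounded below, with values in `(-∞, +∞]`) and transition probability `q`. -/
structure MDP (X A : Type*) [MeasurableSpace X] [MeasurableSpace A] where
  c : X → A → EReal
  q : Kernel (X × A) X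
  markov : IsMarkovKernel q
  c_meas : Measurable fun p : X × A => c p.1 p.2
  c_ne_bot : ∃ K : ℝ, ∀ x a, (K : EReal) ≤ c x a

variable {X A : Type*} [MeasurableSpace X] [MeasurableSpace A]

/-- The deterministic policy given by a measurable map `φ : X → A` applied to the current state. -/
def detPolicy (φ : X → A) (hφ : Measurable φ) : Policy X A :=
  ⟨fun t => Kernel.deterministic (fun h : Hist X A t => φ h.2) (hφ.comp measurable_snd),
   fun _ => by infer_instance⟩

/-- The distribution `P_x^π` of the history `h_t`, constructed recursively
(Ionescu-Tulcea finite-dimensional marginals). -/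
def histMeas (M : MDP X A) (p : Policy X A) (x : X) : ∀ t : ℕ, Measure (Hist X A t)
  | 0 => Measure.dirac (Fin.elim0, x)
  | (t + 1) =>
      (histMeas M p x t).bind fun h =>
        ((p.π t) h).bind fun a =>
          (M.q (h.2, a)).map fun x' => (Fin.snoc h.1 (h.2, a), x')

/-- The joint distribution of the state-action pair `(x_t, a_t)` under `P_x^π`. -/
def saMeas (M : MDP X A) (p : Policy X A) (x : X) (t : ℕ) : Measure (X × A) :=
  (histMeas M p x t).bind fun h => ((p.π t) h).map fun a => (h.2, a)

/-- `E_x^π c(x_t, a_t)`. -/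
def expCost (M : MDP X A) (p : Policy X A) (x : X) (t : ℕ) : EReal :=
  eInt (saMeas M p x t) fun sa => M.c sa.1 sa.2

/-- The expected total discounted cost `v_α^π(x) = E_x^π ∑_t α^t c(x_t, a_t)`. -/
def vDisc (M : MDP X A) (α : ℝ) (p : Policy X A) (x : X) : EReal :=
  eSum fun t => ((α ^ t : ℝ) : EReal) * expCost M p x t

/-- The finite-horizon expected total (undiscounted) cost `v_{N,1}^π(x)`. -/
def vFin (M : MDP X A) (N : ℕ) (p : Policy X A) (x : X) : EReal :=
  ∑ t ∈ Finset.range N, expCost M p x t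

/-- The discounted value function `v_α(x) = inf_π v_α^π(x)`. -/
def vDiscOpt (M : MDP X A) (α : ℝ) (x : X) : EReal :=
  ⨅ p : Policy X A, vDisc M α p x

/-- The average cost per unit time `w^π(x)`. -/
def avgCost (M : MDP X A) (p : Policy X A) (x : X) : EReal :=
  Filter.limsup (fun N : ℕ => (((N : ℝ)⁻¹ : ℝ) : EReal) * vFin M N p x) atTop

/-- The optimal average cost `w(x) = inf_π w^π(x)`. -/
def avgOpt (M : MDP X A) (x : X) : EReal :=
  ⨅ p : Policy X A, avgCost M p x

/-- `w* = inf_x w(x)`. -/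
def wStar (M : MDP X A) : EReal := ⨅ x : X, avgOpt M x

/-- `m_α = inf_x v_α(x)`. -/
def mDisc (M : MDP X A) (α : ℝ) : EReal := ⨅ x : X, vDiscOpt M α x

/-- The discounted relative value function `u_α(x) = v_α(x) - m_α`. -/
def uDisc (M : MDP X A) (α : ℝ) (x : X) : EReal := vDiscOpt M α x - mDisc M α

/-- `w̄ = limsup_{α↑1} (1-α) m_α`. -/
def wBar (M : MDP X A) : EReal :=
  Filter.limsup (fun α : ℝ => ((1 - α : ℝ) : EReal) * mDisc M α) (𝓝[Set.Ico (0:ℝ) 1] 1)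

/-- `w̲ = liminf_{α↑1} (1-α) m_α`. -/
def wLow (M : MDP X A) : EReal :=
  Filter.liminf (fun α : ℝ => ((1 - α : ℝ) : EReal) * mDisc M α) (𝓝[Set.Ico (0:ℝ) 1] 1)

/-- `w̄_{{α_n}} = limsup_n (1-α_n) m_{α_n}`. -/
def wBarSeq (M : MDP X A) (a : ℕ → ℝ) : EReal :=
  Filter.limsup (fun n : ℕ => ((1 - a n : ℝ) : EReal) * mDisc M (a n)) atTop

/-- `w̲_{{α_n}} = liminf_n (1-α_n) m_{α_n}`. -/
def wLowSeq (M : MDP X A) (a : ℕ → ℝ) : EReal :=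
  Filter.liminf (fun n : ℕ => ((1 - a n : ℝ) : EReal) * mDisc M (a n)) atTop

section TopologicalAssumptions

variable {X A : Type*} [MetricSpace X] [TopologicalSpace.SeparableSpace X]
  [MeasurableSpace X] [BorelSpace X] [StandardBorelSpace X]
  [MetricSpace A] [TopologicalSpace.SeparableSpace A]
  [MeasurableSpace A] [BorelSpace A] [StandardBorelSpace A]

/-- Assumption W*(i): the cost `c` is `K`-inf-compact, i.e., for every nonempty compact
`K ⊆ X`, the restriction of `c` to `K × A` has compact sublevel sets. -/
def AssumptionWi (M : MDP X A) : Prop :=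
  ∀ K : Set X, K.Nonempty → IsCompact K →
    ∀ lam : ℝ, IsCompact {p : X × A | p.1 ∈ K ∧ M.c p.1 p.2 ≤ (lam : EReal)}

/-- Assumption W*(ii): the transition probability `q(·|x,a)` is weakly continuous in `(x,a)`. -/
def AssumptionWii (M : MDP X A) : Prop :=
  ∀ f : BoundedContinuousFunction X ℝ, Continuous fun p : X × A => ∫ y, f y ∂ (M.q p)

/-- Assumption S*(i): for each `x`, the function `a ↦ c(x,a)` has compact sublevel sets. -/
def AssumptionSi (M : MDP X A) : Prop :=
  ∀ x : X, ∀ lam : ℝ, IsCompact {a : A | M.c x a ≤ (lam : EReal)}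

/-- Assumption S*(ii): for each `x`, the transition probability `q(·|x,a)` is setwise
continuous in `a`. -/
def AssumptionSii (M : MDP X A) : Prop :=
  ∀ x : X, ∀ B : Set X, MeasurableSet B → Continuous fun a : A => M.q (x, a) B

end TopologicalAssumptions

/-- A sequence of sets is jointly Borel separable if the sets can be enlarged to measurable sets
with empty intersection. -/
def JointlySeparable {Y : Type*} [MeasurableSpace Y] (s : ℕ → Set Y) : Prop :=
  ∃ u : ℕ → Set Y, (∀ n, MeasurableSet (u n)) ∧ (∀ n, s n ⊆ u n) ∧ ⋂ n, u n = ∅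

lemma JointlySeparable.of_iUnion {Y : Type*} [MeasurableSpace Y] {s : ℕ → Set Y} (j : ℕ)
    (t : ℕ → ℕ → Set Y) (ht : ∀ k n, n ≠ j → t k n = s n) (hj : s j ⊆ ⋃ k, t k j)
    (h : ∀ k, JointlySeparable (t k)) : JointlySeparable s := by
  choose u hum hsub hemp using h
  refine ⟨fun n => if n = j then ⋃ k, u k j else ⋂ k, u k n, fun n => ?_, fun n => ?_, ?_⟩
  · by_cases hn : n = j
    · simpa [hn] using MeasurableSet.iUnion fun k => hum k j
    · simpa [hn] using MeasurableSet.iInter fun k => hum k n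
  · by_cases hn : n = j
    · subst hn
      simpa using hj.trans (iUnion_mono fun k => hsub k n)
    · simp only [hn, if_false]
      exact subset_iInter fun k => (ht k n hn) ▸ hsub k n
  · rw [eq_empty_iff_forall_notMem]
    intro y hy
    rw [mem_iInter] at hy
    have hyj := hy j
    simp only [if_true, mem_iUnion] at hyj
    obtain ⟨k, hk⟩ := hyj
    have : y ∈ ⋂ n, u k n := by
      rw [mem_iInter]
      intro n
      by_cases hn : n = j
      · exact hn ▸ hk
      · have := hy n
        simp only [hn, if_false, mem_iInter] at this
        exact this k
    rw [hemp k] at this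
    exact this

/-- Novikov's separation theorem for continuous images of the Baire space. -/
theorem jointlySeparable_range {Y : Type*} [TopologicalSpace Y] [T2Space Y] [MeasurableSpace Y]
    [OpensMeasurableSpace Y] (f : ℕ → (ℕ → ℕ) → Y) (hf : ∀ n, Continuous (f n))
    (hemp : ⋂ n, range (f n) = ∅) : JointlySeparable fun n => range (f n) := by
  by_contra hsep
  let S : ℕ → (ℕ → ℕ) → ℕ → Set Y := fun e z n =>
    f n '' {y | ∀ i, Nat.pair n i < e → y i = z (Nat.pair n i)}
  have hcongr : ∀ e z z', (∀ i < e, z i = z' i) → S e z = S e z' := by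
    intro e z z' h
    funext n
    refine congrArg (fun t => f n '' t) ?_
    ext y
    refine forall_congr' fun i => forall_congr' fun hi => ?_
    rw [h _ hi]
  have step : ∀ e z, ¬ JointlySeparable (S e z) →
      ∃ k, ¬ JointlySeparable (S (e + 1) (Function.update z e k)) := by
    intro e z hz
    by_contra! hk
    refine hz (JointlySeparable.of_iUnion (Nat.unpair e).1 _ (fun k n hn => ?_) ?_ hk)
    · refine congrArg (fun t => f n '' t) ?_
      ext y
      have hne : ∀ i, Nat.pair n i ≠ e := by
        rintro i rfl
        simp at hn
      refine forall_congr' fun i => ?_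
      rw [Function.update_of_ne (hne i)]
      have := hne i
      exact imp_congr_left ⟨fun h => by omega, fun h => by omega⟩
    · rintro _ ⟨y, hy, rfl⟩
      refine mem_iUnion.2 ⟨y (Nat.unpair e).2, y, fun i hi => ?_, rfl⟩
      by_cases hie : Nat.pair (Nat.unpair e).1 i = e
      · rw [hie, Function.update_self]
        have : (Nat.unpair e).2 = i := by
          conv_lhs => rw [← hie]
          simp
        rw [this]
      · rw [Function.update_of_ne hie]
        exact hy i (by omega)
  let P : ℕ → Type := fun e => {z : ℕ → ℕ // ¬ JointlySeparable (S e z)}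
  have h0 : ¬ JointlySeparable (S 0 0) := by
    have : S 0 0 = fun n => range (f n) := by
      funext n
      simp [S]
    rwa [this]
  choose k hk using step
  let Z : ∀ e, P e := fun e => Nat.rec (motive := P) ⟨0, h0⟩
    (fun e z => ⟨Function.update z.1 e (k e z.1 z.2), hk e z.1 z.2⟩) e
  have hZ : ∀ e i, i ≠ e → (Z (e + 1)).1 i = (Z e).1 i := fun e i hi =>
    Function.update_of_ne hi _ _
  have hZ' : ∀ i e, i < e → (Z e).1 i = (Z (i + 1)).1 i := by
    intro i e hie
    induction e, (Nat.succ_le_of_lt hie) using Nat.le_induction with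
    | base => rfl
    | succ e he ih => rw [hZ e i (by omega), ih (by omega)]
  let z : ℕ → ℕ := fun i => (Z (i + 1)).1 i
  have hz : ∀ e, ¬ JointlySeparable (S e z) := by
    intro e
    rw [hcongr e z (Z e).1 fun i hi => (hZ' i e hi).symm]
    exact (Z e).2
  let y : ℕ → ℕ → ℕ := fun n i => z (Nat.pair n i)
  obtain ⟨n, hn⟩ : ∃ n, f n (y n) ≠ f 0 (y 0) := by
    by_contra! h
    have : f 0 (y 0) ∈ ⋂ n, range (f n) := mem_iInter.2 fun n => ⟨y n, h n⟩
    rw [hemp] at this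
    exact this
  obtain ⟨U, W, hU, hW, hnU, h0W, hUW⟩ := t2_separation hn
  have key : ∀ (m : ℕ) (U : Set Y), IsOpen U → f m (y m) ∈ U →
      ∃ e, ∀ e' ≥ e, S e' z m ⊆ U := by
    intro m U hU hmU
    have hmem : f m ⁻¹' U ∈ 𝓝 (y m) := (hf m).continuousAt.preimage_mem_nhds (hU.mem_nhds hmU)
    rw [nhds_pi, Filter.mem_pi] at hmem
    obtain ⟨I, hI, t, ht, hsub⟩ := hmem
    obtain ⟨e, he⟩ : ∃ e, ∀ i ∈ I, Nat.pair m i < e := by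
      obtain ⟨b, hb⟩ := (hI.image (Nat.pair m)).bddAbove
      exact ⟨b + 1, fun i hi => Nat.lt_succ_of_le (hb (mem_image_of_mem _ hi))⟩
    refine ⟨e, fun e' he' => ?_⟩
    rintro _ ⟨x, hx, rfl⟩
    refine hsub fun i hi => ?_
    rw [hx i ((he i hi).trans_le he')]
    exact mem_of_mem_nhds (ht i)
  obtain ⟨e₁, he₁⟩ := key n U hU hnU
  obtain ⟨e₂, he₂⟩ := key 0 W hW h0W
  have hn0 : n ≠ 0 := fun h => hn (by rw [h])
  refine hz (max e₁ e₂) ⟨fun m => if m = n then U else if m = 0 then W else univ,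
    fun m => ?_, fun m => ?_, ?_⟩
  · dsimp only
    split_ifs
    exacts [hU.measurableSet, hW.measurableSet, MeasurableSet.univ]
  · dsimp only
    split_ifs with h1 h2
    · exact h1 ▸ he₁ _ (le_max_left _ _)
    · exact h2 ▸ he₂ _ (le_max_right _ _)
    · exact subset_univ _
  · rw [eq_empty_iff_forall_notMem]
    intro x hx
    rw [mem_iInter] at hx
    have h1 := hx n
    have h2 := hx 0
    simp only [if_true, hn0.symm, if_false] at h1 h2
    exact disjoint_left.1 hUW h1 h2

/-- **Novikov's separation theorem**: a sequence of analytic sets with empty intersection can be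
enlarged to a sequence of Borel sets with empty intersection. -/
theorem jointlySeparable_of_analyticSet {Y : Type*} [TopologicalSpace Y] [T2Space Y]
    [MeasurableSpace Y] [OpensMeasurableSpace Y] {s : ℕ → Set Y} (hs : ∀ n, AnalyticSet (s n))
    (hemp : ⋂ n, s n = ∅) : JointlySeparable s := by
  by_cases h : ∃ n, s n = ∅
  · obtain ⟨n, hn⟩ := h
    refine ⟨fun m => if m = n then ∅ else univ, fun m => ?_, fun m => ?_, ?_⟩
    · dsimp only
      split_ifs
      exacts [MeasurableSet.empty, MeasurableSet.univ]
    · dsimp only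
      split_ifs with h1
      · rw [h1, hn]
      · exact subset_univ _
    · rw [eq_empty_iff_forall_notMem]
      intro x hx
      simpa using mem_iInter.1 hx n
  · push Not at h
    have : ∀ n, ∃ f : (ℕ → ℕ) → Y, Continuous f ∧ range f = s n := by
      intro n
      have := hs n
      rw [AnalyticSet] at this
      exact this.resolve_left (h n).ne_empty
    choose f hf hr using this
    have hs' : s = fun n => range (f n) := funext fun n => (hr n).symm
    rw [hs'] at hemp ⊢
    exact jointlySeparable_range f hf hemp

/-- A Borel set with open sections is a countable union of Borel rectangles with open sides. -/
theorem MeasurableSet.exists_eq_iUnion_prod_of_isOpen_section {X Y : Type*} [TopologicalSpace X]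
    [PolishSpace X] [MeasurableSpace X] [BorelSpace X] [TopologicalSpace Y] [PolishSpace Y]
    [MeasurableSpace Y] [BorelSpace Y] {D : Set (X × Y)} (hD : MeasurableSet D)
    (ho : ∀ x, IsOpen {y | (x, y) ∈ D}) :
    ∃ (C : ℕ → Set X) (V : ℕ → Set Y), (∀ n, MeasurableSet (C n)) ∧ (∀ n, IsOpen (V n)) ∧
      D = ⋃ n, C n ×ˢ V n := by
  obtain ⟨b, hbc, -, hb⟩ := TopologicalSpace.exists_countable_basis Y
  rcases isEmpty_or_nonempty Y with hY | hY
  · exact ⟨fun _ => ∅, fun _ => ∅, fun _ => MeasurableSet.empty, fun _ => isOpen_empty,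
      by ext p; exact (hY.false p.2).elim⟩
  have hbne : b.Nonempty := by
    obtain ⟨y⟩ := hY
    obtain ⟨v, hv, -⟩ := hb.exists_subset_of_mem_open (mem_univ y) isOpen_univ
    exact ⟨v, hv⟩
  obtain ⟨V, rfl⟩ := hbc.exists_eq_range hbne
  have hV : ∀ n, IsOpen (V n) := fun n => hb.isOpen (mem_range_self n)
  -- the points whose section does not contain `V n`
  let N : ℕ → Set X := fun n => Prod.fst '' (Dᶜ ∩ univ ×ˢ V n)
  have hN : ∀ n, AnalyticSet (N n) := fun n =>
    ((hD.compl.inter (MeasurableSet.univ.prod (hV n).measurableSet)).analyticSet).image_of_continuous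
      continuous_fst
  have hNV : ∀ n x y, x ∉ N n → y ∈ V n → (x, y) ∈ D := by
    intro n x y hx hy
    by_contra hxy
    exact hx ⟨(x, y), ⟨hxy, mem_univ _, hy⟩, rfl⟩
  let s : ℕ → Set (X × Y) := fun n => D ∩ (univ ×ˢ (V n)ᶜ ∪ Prod.fst ⁻¹' N n)
  have hs : ∀ n, AnalyticSet (s n) := by
    intro n
    have h1 : AnalyticSet (univ ×ˢ (V n)ᶜ : Set (X × Y)) :=
      (MeasurableSet.univ.prod (hV n).measurableSet.compl).analyticSet
    have h2 : AnalyticSet (Prod.fst ⁻¹' N n : Set (X × Y)) := (hN n).preimage continuous_fst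
    have h3 : AnalyticSet (univ ×ˢ (V n)ᶜ ∪ Prod.fst ⁻¹' N n : Set (X × Y)) := by
      rw [union_eq_iUnion]
      exact AnalyticSet.iUnion fun b => by cases b <;> assumption
    have : s n = ⋂ b : Bool, cond b D (univ ×ˢ (V n)ᶜ ∪ Prod.fst ⁻¹' N n) :=
      inter_eq_iInter
    rw [this]
    exact AnalyticSet.iInter fun b => by
      cases b
      · exact h3
      · exact hD.analyticSet
  have hemp : ⋂ n, s n = ∅ := by
    rw [eq_empty_iff_forall_notMem]
    rintro ⟨x, y⟩ hxy
    rw [mem_iInter] at hxy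
    have hmem : (x, y) ∈ D := (hxy 0).1
    obtain ⟨_, ⟨n, rfl⟩, hyn, hsub⟩ := hb.exists_subset_of_mem_open
      (show y ∈ {y | (x, y) ∈ D} from hmem) (ho x)
    rcases (hxy n).2 with h | ⟨⟨x', y'⟩, ⟨h1, -, h2⟩, rfl⟩
    · exact h.2 hyn
    · exact h1 (hsub h2)
  obtain ⟨u, hum, hsu, hu⟩ := jointlySeparable_of_analyticSet hs hemp
  have hBsub : ∀ n x y, (x, y) ∈ D \ u n → x ∉ N n ∧ y ∈ V n := by
    intro n x y h
    constructor
    · exact fun hx => h.2 (hsu n ⟨h.1, Or.inr hx⟩)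
    · by_contra hy
      exact h.2 (hsu n ⟨h.1, Or.inl ⟨mem_univ _, hy⟩⟩)
  have hsep : ∀ n, ∃ C : Set X, Prod.fst '' (D \ u n) ⊆ C ∧ Disjoint (N n) C ∧
      MeasurableSet C := by
    intro n
    refine (((hD.diff (hum n)).analyticSet.image_of_continuous continuous_fst).measurablySeparable
      (hN n) ?_)
    rw [disjoint_left]
    rintro _ ⟨⟨x, y⟩, h, rfl⟩
    exact (hBsub n x y h).1
  choose C hC1 hC2 hC3 using hsep
  refine ⟨C, V, hC3, hV, ?_⟩
  ext ⟨x, y⟩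
  simp only [mem_iUnion, mem_prod]
  constructor
  · intro h
    have : (x, y) ∉ ⋂ n, u n := by rw [hu]; exact notMem_empty _
    rw [mem_iInter] at this
    push Not at this
    obtain ⟨n, hn⟩ := this
    exact ⟨n, hC1 n ⟨(x, y), ⟨h, hn⟩, rfl⟩, (hBsub n x y ⟨h, hn⟩).2⟩
  · rintro ⟨n, hx, hy⟩
    exact hNV n x y (disjoint_right.1 (hC2 n) hx) hy

lemma measurableSet_image_fst_of_compactSpace {X Y : Type*} [MeasurableSpace X]
    [StandardBorelSpace X] [TopologicalSpace Y] [PolishSpace Y] [CompactSpace Y]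
    [MeasurableSpace Y] [BorelSpace Y] {B : Set (X × Y)} (hB : MeasurableSet B)
    (hc : ∀ x, IsClosed {y | (x, y) ∈ B}) : MeasurableSet (Prod.fst '' B) := by
  let := upgradeStandardBorel X
  obtain ⟨C, V, hC, hV, hCV⟩ := hB.compl.exists_eq_iUnion_prod_of_isOpen_section
    fun x => (hc x).isOpen_compl
  have : (Prod.fst '' B)ᶜ = ⋃ (F : Finset ℕ) (_ : ⋃ n ∈ F, V n = univ), ⋂ n ∈ F, C n := by
    ext x
    simp only [mem_compl_iff, mem_iUnion, mem_iInter, exists_prop]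
    constructor
    · intro hx
      have hcov : (univ : Set Y) ⊆ ⋃ n : {n // x ∈ C n}, V n := by
        intro y _
        have : (x, y) ∈ Bᶜ := fun h => hx ⟨_, h, rfl⟩
        rw [hCV, mem_iUnion] at this
        obtain ⟨n, h1, h2⟩ := this
        exact mem_iUnion.2 ⟨⟨n, h1⟩, h2⟩
      obtain ⟨F, hF⟩ := isCompact_univ.elim_finite_subcover _
        (fun n : {n // x ∈ C n} => hV n.1) hcov
      refine ⟨F.map (Function.Embedding.subtype _), ?_, ?_⟩
      · rw [eq_univ_iff_forall]
        intro y
        obtain ⟨n, hn, hy⟩ := mem_iUnion₂.1 (hF (mem_univ y))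
        exact mem_iUnion₂.2 ⟨n.1, Finset.mem_map.2 ⟨n, hn, rfl⟩, hy⟩
      · intro n hn
        obtain ⟨m, -, rfl⟩ := Finset.mem_map.1 hn
        exact m.2
    · rintro ⟨F, hF, hx⟩ ⟨⟨x', y⟩, hxy, rfl⟩
      have : y ∈ ⋃ n ∈ F, V n := hF ▸ mem_univ y
      obtain ⟨n, hn, hy⟩ := mem_iUnion₂.1 this
      have : (x', y) ∈ Bᶜ := hCV ▸ mem_iUnion.2 ⟨n, hx n hn, hy⟩
      exact this hxy
  rw [← MeasurableSet.compl_iff, this]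
  exact MeasurableSet.iUnion fun F => MeasurableSet.iUnion fun _ =>
    Finset.measurableSet_biInter F fun n _ => hC n

/-- The projection of a Borel set with compact sections is Borel. -/
theorem measurableSet_image_fst_of_isCompact {X A : Type*} [MeasurableSpace X]
    [StandardBorelSpace X] [MetricSpace A] [TopologicalSpace.SeparableSpace A]
    [MeasurableSpace A] [BorelSpace A] [StandardBorelSpace A] {B : Set (X × A)}
    (hB : MeasurableSet B) (hc : ∀ x, IsCompact {a | (x, a) ∈ B}) :
    MeasurableSet (Prod.fst '' B) := by
  obtain ⟨F, hF⟩ := Metric.PiNatEmbed.exists_embedding_to_hilbert_cube (X := A)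
  have hFm : MeasurableEmbedding F := hF.continuous.measurable.measurableEmbedding hF.injective
  have hG : MeasurableEmbedding (Prod.map (id : X → X) F) := MeasurableEmbedding.id.prodMap hFm
  have hsec : ∀ x, {y | (x, y) ∈ Prod.map (id : X → X) F '' B} = F '' {a | (x, a) ∈ B} := by
    intro x
    ext y
    constructor
    · rintro ⟨⟨x', a⟩, h, he⟩
      obtain ⟨rfl, rfl⟩ := Prod.mk.inj he
      exact ⟨a, h, rfl⟩
    · rintro ⟨a, h, rfl⟩
      exact ⟨(x, a), h, rfl⟩
  have := measurableSet_image_fst_of_compactSpace (hG.measurableSet_image' hB) fun x => by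
    rw [hsec]
    exact ((hc x).image hF.continuous).isClosed
  rw [image_image] at this
  exact this

/-- A function whose sections in the second variable have compact sublevel sets. -/
def SectionInfCompact {X A : Type*} [TopologicalSpace A] (f : X × A → ℝ≥0∞) : Prop :=
  ∀ x, ∀ r : ℝ≥0∞, r ≠ ⊤ → IsCompact {a | f (x, a) ≤ r}

namespace SectionInfCompact

lemma lowerSemicontinuous {X A : Type*} [TopologicalSpace A] [T2Space A] {f : X × A → ℝ≥0∞}
    (hf : SectionInfCompact f) (x : X) : LowerSemicontinuous fun a => f (x, a) := by
  rw [lowerSemicontinuous_iff_isClosed_preimage]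
  intro r
  by_cases hr : r = ⊤
  · simp [hr]
  · exact (hf x r hr).isClosed

lemma exists_eq_iInf {X A : Type*} [TopologicalSpace A] [T2Space A] [Nonempty A]
    {f : X × A → ℝ≥0∞} (hf : SectionInfCompact f) (x : X) :
    ∃ a, f (x, a) = ⨅ b, f (x, b) := by
  by_cases htop : ∀ b, f (x, b) = ⊤
  · obtain ⟨a⟩ := ‹Nonempty A›
    exact ⟨a, by rw [htop a, eq_comm, iInf_eq_top]; exact htop⟩
  · push Not at htop
    obtain ⟨b, hb⟩ := htop
    obtain ⟨a, -, hmin⟩ := ((hf.lowerSemicontinuous x).lowerSemicontinuousOn _).exists_isMinOn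
      ⟨b, le_refl (f (x, b))⟩ (hf x _ hb)
    refine ⟨a, le_antisymm (le_iInf fun b' => ?_) (iInf_le _ a)⟩
    have hab : f (x, a) ≤ f (x, b) := hmin (le_refl (f (x, b)))
    rcases le_total (f (x, b')) (f (x, b)) with h | h
    · exact hmin h
    · exact hab.trans h

lemma iSup_iInf_eq {X A : Type*} [TopologicalSpace A] [T2Space A] [Nonempty A]
    {f : ℕ → X × A → ℝ≥0∞} (hf : ∀ n, SectionInfCompact (f n)) (hmono : Monotone f) (x : X) :
    ⨆ n, ⨅ a, f n (x, a) = ⨅ a, ⨆ n, f n (x, a) := by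
  refine le_antisymm (le_iInf fun a => iSup_mono fun n => iInf_le _ a) ?_
  by_cases htop : ⨆ n, ⨅ a, f n (x, a) = ⊤
  · rw [htop]
    exact le_top
  obtain ⟨a, ha⟩ := IsCompact.nonempty_iInter_of_sequence_nonempty_isCompact_isClosed
    (fun n => {a | f n (x, a) ≤ ⨆ n, ⨅ a, f n (x, a)})
    (fun n a ha => (hmono (Nat.le_succ n) (x, a)).trans ha)
    (fun n => by
      obtain ⟨a, ha⟩ := (hf n).exists_eq_iInf x
      exact ⟨a, ha.trans_le (le_iSup (fun n => ⨅ a, f n (x, a)) n)⟩)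
    (hf 0 x _ htop) (fun n => (hf n x _ htop).isClosed)
  exact (iInf_le _ a).trans (iSup_le fun n => mem_iInter.1 ha n)

section Selection

variable {X A : Type*} [MeasurableSpace X] [StandardBorelSpace X] [MetricSpace A]
  [TopologicalSpace.SeparableSpace A] [MeasurableSpace A] [BorelSpace A] [StandardBorelSpace A]

theorem measurable_iInf {f : X × A → ℝ≥0∞} (hf : SectionInfCompact f) (hm : Measurable f) :
    Measurable fun x => ⨅ a, f (x, a) := by
  rcases isEmpty_or_nonempty A with hA | hA
  · simpa only [iInf_of_empty] using measurable_const
  refine measurable_of_Iic fun r => ?_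
  by_cases hr : r = ⊤
  · simp [hr]
  have : (fun x => ⨅ a, f (x, a)) ⁻¹' Iic r = Prod.fst '' {p | f p ≤ r} := by
    ext x
    constructor
    · intro hx
      obtain ⟨a, ha⟩ := hf.exists_eq_iInf x
      exact ⟨(x, a), ha.trans_le hx, rfl⟩
    · rintro ⟨⟨x, a⟩, h, rfl⟩
      exact (iInf_le (fun a => f (x, a)) a).trans h
  rw [this]
  exact measurableSet_image_fst_of_isCompact (measurableSet_le hm measurable_const)
    fun x => hf x r hr

lemma exists_isCompact_subset_edist_eq {B : Set (X × A)} (hB : MeasurableSet B)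
    (hc : ∀ x, IsCompact {a | (x, a) ∈ B}) (d : A) :
    ∃ B' ⊆ B, MeasurableSet B' ∧ (∀ x, IsCompact {a | (x, a) ∈ B'}) ∧
      (∀ x, (∃ a, (x, a) ∈ B) → ∃ a, (x, a) ∈ B') ∧
      ∀ x a a', (x, a) ∈ B' → (x, a') ∈ B' → edist a d = edist a' d := by
  classical
  have : Nonempty A := ⟨d⟩
  let g : X × A → ℝ≥0∞ := fun p => if p ∈ B then edist p.2 d else ⊤
  have hgm : Measurable g := Measurable.ite hB (measurable_snd.edist measurable_const)
    measurable_const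
  have hclosed : ∀ r, IsClosed {a : A | edist a d ≤ r} := fun r =>
    isClosed_le (by fun_prop) continuous_const
  have hg : SectionInfCompact g := by
    intro x r hr
    have : {a | g (x, a) ≤ r} = {a | (x, a) ∈ B} ∩ {a | edist a d ≤ r} := by
      ext a
      by_cases h : (x, a) ∈ B <;> simp [g, h, hr]
    rw [this]
    exact (hc x).inter_right (hclosed r)
  refine ⟨B ∩ {p | edist p.2 d ≤ ⨅ b, g (p.1, b)}, inter_subset_left, ?_, fun x => ?_, ?_, ?_⟩
  · exact hB.inter (measurableSet_le (measurable_snd.edist measurable_const)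
      ((hg.measurable_iInf hgm).comp measurable_fst))
  · have : {a | (x, a) ∈ B ∩ {p | edist p.2 d ≤ ⨅ b, g (p.1, b)}} =
        {a | (x, a) ∈ B} ∩ {a | edist a d ≤ ⨅ b, g (x, b)} := by
      ext a
      simp only [mem_inter_iff, mem_ofPred_eq]
    rw [this]
    exact (hc x).inter_right (hclosed _)
  · rintro x ⟨a, ha⟩
    obtain ⟨b, hb⟩ := hg.exists_eq_iInf x
    have hlt : g (x, b) < ⊤ := by
      refine (hb.trans_le (iInf_le _ a)).trans_lt ?_
      simp [g, ha, edist_lt_top]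
    have hbB : (x, b) ∈ B := by
      by_contra h
      simp [g, h] at hlt
    refine ⟨b, hbB, ?_⟩
    have : g (x, b) = edist b d := by simp [g, hbB]
    exact (this ▸ hb).le
  · have key : ∀ x a a', (x, a) ∈ B → edist a d ≤ ⨅ b, g (x, b) → (x, a') ∈ B →
        edist a d ≤ edist a' d := fun x a a' _ h ha' =>
      h.trans ((iInf_le _ a').trans_eq (by simp [g, ha']))
    exact fun x a a' h h' => le_antisymm (key x a a' h.1 h.2 h'.1) (key x a' a h'.1 h'.2 h.1)

/-- A Borel set with compact sections has a Borel uniformization. -/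
theorem exists_measurable_selection [Nonempty A] {B : Set (X × A)} (hB : MeasurableSet B)
    (hc : ∀ x, IsCompact {a | (x, a) ∈ B}) :
    ∃ φ : X → A, Measurable φ ∧ ∀ x, (∃ a, (x, a) ∈ B) → (x, φ x) ∈ B := by
  classical
  let P := {B : Set (X × A) // MeasurableSet B ∧ ∀ x, IsCompact {a | (x, a) ∈ B}}
  have step : ∀ (S : P) (d : A), ∃ S' : P, S'.1 ⊆ S.1 ∧
      (∀ x, (∃ a, (x, a) ∈ S.1) → ∃ a, (x, a) ∈ S'.1) ∧
      ∀ x a a', (x, a) ∈ S'.1 → (x, a') ∈ S'.1 → edist a d = edist a' d := by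
    intro S d
    obtain ⟨B', h1, h2, h3, h4⟩ := exists_isCompact_subset_edist_eq S.2.1 S.2.2 d
    exact ⟨⟨B', h2, h3⟩, h1, h4⟩
  choose next hsub hne heq using step
  let S : ℕ → P := fun n => Nat.rec ⟨B, hB, hc⟩
    (fun n T => next T (TopologicalSpace.denseSeq A n)) n
  have hSsub : ∀ n, (S (n + 1)).1 ⊆ (S n).1 := fun n => hsub _ _
  have hSne : ∀ x, (∃ a, (x, a) ∈ B) → ∀ n, ∃ a, (x, a) ∈ (S n).1 := by
    intro x hx n
    induction n with
    | zero => exact hx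
    | succ n ih => exact hne _ _ x ih
  let G : Set (X × A) := ⋂ n, (S n).1
  have hGm : MeasurableSet G := MeasurableSet.iInter fun n => (S n).2.1
  have hGB : G ⊆ B := iInter_subset _ 0
  have hGc : ∀ x, IsCompact {a | (x, a) ∈ G} := by
    intro x
    have : {a | (x, a) ∈ G} = ⋂ n, {a | (x, a) ∈ (S n).1} := by
      ext a
      simp [G]
    rw [this]
    exact ((S 0).2.2 x).of_isClosed_subset (isClosed_iInter fun n => ((S n).2.2 x).isClosed)
      (iInter_subset _ 0)
  have hGne : ∀ x, (∃ a, (x, a) ∈ B) → ∃ a, (x, a) ∈ G := by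
    intro x hx
    obtain ⟨a, ha⟩ := IsCompact.nonempty_iInter_of_sequence_nonempty_isCompact_isClosed
      (fun n => {a | (x, a) ∈ (S n).1}) (fun n a ha => hSsub n ha) (fun n => hSne x hx n)
      ((S 0).2.2 x) (fun n => ((S n).2.2 x).isClosed)
    exact ⟨a, mem_iInter.2 fun n => mem_iInter.1 ha n⟩
  have hGu : ∀ x a a', (x, a) ∈ G → (x, a') ∈ G → a = a' := by
    intro x a a' ha ha'
    have h : (fun d => edist a d) = fun d => edist a' d := by
      refine (TopologicalSpace.denseRange_denseSeq A).equalizer (by fun_prop) (by fun_prop) ?_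
      funext n
      exact heq _ _ x a a' (mem_iInter.1 ha (n + 1)) (mem_iInter.1 ha' (n + 1))
    have := congrFun h a'
    simpa using this
  obtain ⟨a₀⟩ := ‹Nonempty A›
  let φ : X → A := fun x => if h : ∃ a, (x, a) ∈ G then h.choose else a₀
  have hφ : ∀ x, (∃ a, (x, a) ∈ G) → (x, φ x) ∈ G := by
    intro x h
    simp only [φ, h, dif_pos]
    exact h.choose_spec
  have hφ' : ∀ x, (¬ ∃ a, (x, a) ∈ G) → φ x = a₀ := by
    intro x h
    simp only [φ, h, dif_neg, not_false_eq_true]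
  refine ⟨φ, measurable_of_isClosed fun C hC => ?_, fun x hx => hGB (hφ x (hGne x hx))⟩
  have h1 : MeasurableSet (Prod.fst '' (G ∩ univ ×ˢ C)) := by
    refine measurableSet_image_fst_of_isCompact
      (hGm.inter (MeasurableSet.univ.prod hC.measurableSet)) fun x => ?_
    have : {a | (x, a) ∈ G ∩ univ ×ˢ C} = {a | (x, a) ∈ G} ∩ C := by
      ext a
      simp
    rw [this]
    exact (hGc x).inter_right hC
  have h2 : MeasurableSet (Prod.fst '' G) := measurableSet_image_fst_of_isCompact hGm hGc
  have : φ ⁻¹' C = Prod.fst '' (G ∩ univ ×ˢ C) ∪ ((Prod.fst '' G)ᶜ ∩ {_x | a₀ ∈ C}) := by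
    ext x
    by_cases h : ∃ a, (x, a) ∈ G
    · have hmem : x ∈ Prod.fst '' G := ⟨(x, φ x), hφ x h, rfl⟩
      simp only [mem_preimage, mem_union, mem_inter_iff, mem_compl_iff, hmem, not_true_eq_false,
        false_and, or_false]
      constructor
      · exact fun hx => ⟨(x, φ x), ⟨hφ x h, mem_univ _, hx⟩, rfl⟩
      · rintro ⟨⟨x', a⟩, ⟨ha, -, haC⟩, rfl⟩
        rwa [hGu _ _ _ (hφ x' h) ha]
    · have hnot : ∀ T ⊆ G, x ∉ Prod.fst '' T := by
        rintro T hT ⟨⟨x', a⟩, ha, rfl⟩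
        exact h ⟨a, hT ha⟩
      have h3 := hnot G Subset.rfl
      have h4 := hnot (G ∩ univ ×ˢ C) inter_subset_left
      simp only [mem_preimage, hφ' x h, mem_union, h4, mem_inter_iff, mem_compl_iff, h3,
        mem_ofPred_eq, false_or, not_false_eq_true, true_and]
  rw [this]
  exact h1.union (h2.compl.inter (MeasurableSet.const _))

/-- Measurable selection of minimizers. -/
theorem exists_measurable_eq_iInf [Nonempty A] {f : X × A → ℝ≥0∞} (hf : SectionInfCompact f)
    (hm : Measurable f) : ∃ φ : X → A, Measurable φ ∧ ∀ x, f (x, φ x) = ⨅ a, f (x, a) := by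
  have hv := hf.measurable_iInf hm
  obtain ⟨φ, hφ, hsel⟩ := exists_measurable_selection
    (B := {p | f p ≤ ⨅ a, f (p.1, a)} ∩ {p | (⨅ a, f (p.1, a)) < ⊤})
    ((measurableSet_le hm (hv.comp measurable_fst)).inter
      (measurableSet_lt (hv.comp measurable_fst) measurable_const))
    (fun x => by
      by_cases h : ⨅ a, f (x, a) = ⊤
      · have : {a | (x, a) ∈ {p | f p ≤ ⨅ a, f (p.1, a)} ∩ {p | (⨅ a, f (p.1, a)) < ⊤}} = ∅ := by
          ext a
          simp only [mem_inter_iff, mem_ofPred_eq, h, lt_self_iff_false, and_false,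
            mem_empty_iff_false]
        rw [this]
        exact isCompact_empty
      · have : {a | (x, a) ∈ {p | f p ≤ ⨅ a, f (p.1, a)} ∩ {p | (⨅ a, f (p.1, a)) < ⊤}} =
            {a | f (x, a) ≤ ⨅ a, f (x, a)} := by
          ext a
          simp only [mem_inter_iff, mem_ofPred_eq, lt_top_iff_ne_top, ne_eq, h, not_false_eq_true,
            and_true]
        rw [this]
        exact hf x _ h)
  refine ⟨φ, hφ, fun x => ?_⟩
  by_cases h : ⨅ a, f (x, a) = ⊤
  · rw [h]
    exact iInf_eq_top.1 h _
  · obtain ⟨a, ha⟩ := hf.exists_eq_iInf x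
    exact le_antisymm (hsel x ⟨a, ha.le, lt_top_iff_ne_top.2 h⟩).1 (iInf_le _ _)

end Selection

end SectionInfCompact

section LowerSemicontinuousIntegral

lemma ENNReal.tsum_indicator_lt_bounds (z : ℝ≥0∞) :
    (∑' i : ℕ, {z : ℝ≥0∞ | (i : ℝ≥0∞) + 1 < z}.indicator 1 z) ≤ z ∧
      z ≤ (∑' i : ℕ, {z : ℝ≥0∞ | (i : ℝ≥0∞) + 1 < z}.indicator 1 z) + 1 := by
  rcases eq_or_ne z ⊤ with rfl | hz
  · refine ⟨le_top, ?_⟩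
    simp
  · lift z to ℝ≥0 using hz
    have hiff : ∀ i : ℕ, ((i : ℝ≥0∞) + 1 < z) ↔ i < ⌈z⌉₊ - 1 := by
      intro i
      have : ((i : ℝ≥0∞) + 1 < z) ↔ ((i + 1 : ℕ) : ℝ≥0) < z := by
        rw [← ENNReal.coe_lt_coe]
        push_cast
        rfl
      rw [this, ← Nat.lt_ceil]
      omega
    have hsum : (∑' i : ℕ, {z : ℝ≥0∞ | (i : ℝ≥0∞) + 1 < z}.indicator 1 (z : ℝ≥0∞)) =
        ((⌈z⌉₊ - 1 : ℕ) : ℝ≥0∞) := by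
      rw [tsum_eq_sum (s := Finset.range (⌈z⌉₊ - 1))]
      · rw [Finset.sum_congr rfl (g := fun _ => (1 : ℝ≥0∞))]
        · simp
        · intro i hi
          exact indicator_of_mem (s := {z : ℝ≥0∞ | (i : ℝ≥0∞) + 1 < z})
            ((hiff i).2 (Finset.mem_range.1 hi)) _
      · intro i hi
        exact indicator_of_notMem (s := {z : ℝ≥0∞ | (i : ℝ≥0∞) + 1 < z})
          (fun h => hi (Finset.mem_range.2 ((hiff i).1 h))) _
    rw [hsum]
    constructor
    · generalize ⌈z⌉₊ - 1 = k at hiff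
      rcases k with _ | k
      · simp
      · rw [Nat.cast_succ]
        exact ((hiff k).2 k.lt_succ_self).le
    · have h1 : z ≤ (⌈z⌉₊ : ℝ≥0) := Nat.le_ceil z
      have h2 : ((⌈z⌉₊ : ℕ) : ℝ≥0∞) ≤ ((⌈z⌉₊ - 1 : ℕ) : ℝ≥0∞) + 1 := by
        rw [← Nat.cast_succ]
        exact Nat.cast_le.2 (by omega)
      exact (ENNReal.coe_le_coe.2 h1).trans h2

/-- If all superlevel sets of `V` have lower semicontinuous measure, then so does the integral
of `V`. -/
theorem lowerSemicontinuous_lintegral_of_superlevel {T Y : Type*} [TopologicalSpace T]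
    [MeasurableSpace Y] {μ : T → Measure Y} [∀ t, IsProbabilityMeasure (μ t)] {V : Y → ℝ≥0∞}
    (hV : Measurable V) (h : ∀ r : ℝ≥0∞, LowerSemicontinuous fun t => μ t {y | r < V y}) :
    LowerSemicontinuous fun t => ∫⁻ y, V y ∂μ t := by
  let N : ℕ → ℝ≥0∞ := fun n => (n : ℝ≥0∞) + 1
  have hN0 : ∀ n, N n ≠ 0 := fun n => by simp [N]
  have hNt : ∀ n, N n ≠ ⊤ := fun n => by simp [N]
  let G : ℕ → T → ℝ≥0∞ := fun n t => (N n)⁻¹ * ∑' i : ℕ, μ t {y | ((i : ℝ≥0∞) + 1) / N n < V y}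
  have hG : ∀ n t, G n t ≤ ∫⁻ y, V y ∂μ t ∧ ∫⁻ y, V y ∂μ t ≤ G n t + (N n)⁻¹ := by
    intro n t
    have hset : ∀ i : ℕ, {y | ((i : ℝ≥0∞) + 1) / N n < V y} =
        (fun y => N n * V y) ⁻¹' {z : ℝ≥0∞ | (i : ℝ≥0∞) + 1 < z} := by
      intro i
      ext y
      simp only [mem_ofPred_eq, mem_preimage]
      rw [ENNReal.div_lt_iff (Or.inl (hN0 n)) (Or.inl (hNt n)), mul_comm]
    have hsum : ∑' i : ℕ, μ t {y | ((i : ℝ≥0∞) + 1) / N n < V y} =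
        ∫⁻ y, ∑' i : ℕ, {z : ℝ≥0∞ | (i : ℝ≥0∞) + 1 < z}.indicator 1 (N n * V y) ∂μ t := by
      rw [lintegral_tsum]
      · refine tsum_congr fun i => ?_
        rw [← lintegral_indicator_one (measurableSet_lt measurable_const hV), hset]
        rfl
      · intro i
        exact ((measurable_one.indicator (measurableSet_lt measurable_const measurable_id)).comp
          (hV.const_mul (N n))).aemeasurable
    have hInt : ∫⁻ y, V y ∂μ t = (N n)⁻¹ * ∫⁻ y, N n * V y ∂μ t := by
      rw [lintegral_const_mul _ hV, ← mul_assoc, ENNReal.inv_mul_cancel (hN0 n) (hNt n), one_mul]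
    simp only [G]
    rw [hInt, hsum]
    constructor
    · gcongr with y
      exact (ENNReal.tsum_indicator_lt_bounds _).1
    · calc (N n)⁻¹ * ∫⁻ y, N n * V y ∂μ t
          ≤ (N n)⁻¹ * ∫⁻ y, ((∑' i : ℕ,
              {z : ℝ≥0∞ | (i : ℝ≥0∞) + 1 < z}.indicator 1 (N n * V y)) + 1) ∂μ t := by
            gcongr with y
            exact (ENNReal.tsum_indicator_lt_bounds _).2
        _ = _ := by
            rw [lintegral_add_right _ measurable_const]
            simp [mul_add]
  have hsup : (fun t => ∫⁻ y, V y ∂μ t) = fun t => ⨆ n, G n t := by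
    funext t
    refine le_antisymm ?_ (iSup_le fun n => (hG n t).1)
    have hlim : Tendsto (fun n => (⨆ n, G n t) + (N n)⁻¹) atTop (𝓝 ((⨆ n, G n t) + 0)) := by
      refine tendsto_const_nhds.add ?_
      have := (tendsto_add_atTop_iff_nat 1).2 ENNReal.tendsto_inv_nat_nhds_zero
      simpa [N] using this
    rw [add_zero] at hlim
    exact ge_of_tendsto' hlim fun n => (hG n t).2.trans
      (add_le_add_left (le_iSup (fun n => G n t) n) _)
  rw [hsup]
  refine lowerSemicontinuous_iSup fun n => ?_
  exact Continuous.comp_lowerSemicontinuous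
    (ENNReal.continuous_const_mul (ENNReal.inv_ne_top.2 (hN0 n)))
    (lowerSemicontinuous_tsum fun i => h _) fun a b hab => by gcongr

end LowerSemicontinuousIntegral

section ValueClass

variable {X A : Type*} [MeasurableSpace X] [MeasurableSpace A]

/-- The one-step Bellman cost `c(x,a) + β ∫ V dq(·|x,a)`. -/
def bellman (c : X × A → ℝ≥0∞) (q : Kernel (X × A) X) (β : ℝ≥0∞) (V : X → ℝ≥0∞) :
    X × A → ℝ≥0∞ := fun p => c p + β * ∫⁻ y, V y ∂q p

lemma measurable_bellman {c : X × A → ℝ≥0∞} (hc : Measurable c) (q : Kernel (X × A) X)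
    (β : ℝ≥0∞) {V : X → ℝ≥0∞} (hV : Measurable V) : Measurable (bellman c q β V) :=
  hc.add ((hV.lintegral_kernel).const_mul β)

lemma bellman_mono (c : X × A → ℝ≥0∞) (q : Kernel (X × A) X) {β β' : ℝ≥0∞} (hβ : β ≤ β')
    {V V' : X → ℝ≥0∞} (hV : V ≤ V') : bellman c q β V ≤ bellman c q β' V' := fun _ =>
  add_le_add_right (mul_le_mul' hβ (lintegral_mono hV)) _

lemma iSup_bellman (c : X × A → ℝ≥0∞) (q : Kernel (X × A) X) {β : ℕ → ℝ≥0∞} (hβ : Monotone β)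
    {V : ℕ → X → ℝ≥0∞} (hVm : ∀ n, Measurable (V n)) (hV : Monotone V) (p : X × A) :
    ⨆ n, bellman c q (β n) (V n) p = bellman c q (⨆ n, β n) (fun x => ⨆ n, V n x) p := by
  simp only [bellman]
  rw [lintegral_iSup hVm hV, ENNReal.iSup_mul, ← ENNReal.add_iSup]
  congr 1
  simp only [ENNReal.mul_iSup]
  refine le_antisymm (iSup_le fun n => le_iSup₂_of_le n n le_rfl) (iSup₂_le fun m n => ?_)
  refine le_iSup_of_le (max m n) (mul_le_mul' (hβ (le_max_left m n)) ?_)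
  exact lintegral_mono (hV (le_max_right m n))

/-- A class of value functions that is stable under the operations of dynamic programming. -/
structure IsValueClass [TopologicalSpace A] (c : X × A → ℝ≥0∞) (q : Kernel (X × A) X)
    (L : Set (X → ℝ≥0∞)) : Prop where
  zero_mem : (fun _ => 0) ∈ L
  measurable : ∀ V ∈ L, Measurable V
  sectionInfCompact : ∀ V ∈ L, ∀ β : ℝ≥0∞, β ≠ ⊤ → SectionInfCompact (bellman c q β V)
  iInf_bellman_mem : ∀ V ∈ L, ∀ β : ℝ≥0∞, β ≠ ⊤ → (fun x => ⨅ a, bellman c q β V (x, a)) ∈ L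
  iSup_mem : ∀ V : ℕ → X → ℝ≥0∞, (∀ n, V n ∈ L) → (fun x => ⨆ n, V n x) ∈ L
  sub_mem : ∀ V ∈ L, ∀ r : ℝ≥0∞, r ≠ ⊤ → (fun x => V x - r) ∈ L
  exists_envelope : ∀ V : ℕ → X → ℝ≥0∞, (∀ n, V n ∈ L) →
    ∃ E ∈ L, (∀ n, E ≤ V n) ∧ ∀ g ∈ L, (∀ n, g ≤ V n) → g ≤ E

lemma sectionInfCompact_bellman [TopologicalSpace A] [T2Space A] {c : X × A → ℝ≥0∞}
    {q : Kernel (X × A) X} (hc : SectionInfCompact c) {β : ℝ≥0∞} (hβ : β ≠ ⊤) {V : X → ℝ≥0∞}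
    (hV : ∀ x, LowerSemicontinuous fun a => ∫⁻ y, V y ∂q (x, a)) :
    SectionInfCompact (bellman c q β V) := by
  intro x r hr
  have hlsc : LowerSemicontinuous fun a => bellman c q β V (x, a) :=
    (hc.lowerSemicontinuous x).add (Continuous.comp_lowerSemicontinuous
      (ENNReal.continuous_const_mul hβ) (hV x) fun a b hab => by gcongr)
  refine (hc x r hr).of_isClosed_subset
    (lowerSemicontinuous_iff_isClosed_preimage.1 hlsc r) fun a ha => ?_
  exact le_trans le_self_add (show bellman c q β V (x, a) ≤ r from ha)

/-- Under setwise continuity, the measurable functions form a value class. -/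
theorem isValueClass_measurable [StandardBorelSpace X] [MetricSpace A]
    [TopologicalSpace.SeparableSpace A] [BorelSpace A] [StandardBorelSpace A]
    {c : X × A → ℝ≥0∞} (hcm : Measurable c) (hc : SectionInfCompact c) {q : Kernel (X × A) X}
    [IsMarkovKernel q] (hq : ∀ x B, MeasurableSet B → Continuous fun a => q (x, a) B) :
    IsValueClass c q {V | Measurable V} := by
  have hsic : ∀ V : X → ℝ≥0∞, Measurable V → ∀ β : ℝ≥0∞, β ≠ ⊤ →
      SectionInfCompact (bellman c q β V) := fun V hV β hβ =>
    sectionInfCompact_bellman hc hβ fun x => lowerSemicontinuous_lintegral_of_superlevel hV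
      fun r => (hq x _ (measurableSet_lt measurable_const hV)).lowerSemicontinuous
  exact
  { zero_mem := measurable_const
    measurable := fun V hV => hV
    sectionInfCompact := hsic
    iInf_bellman_mem := fun V hV β hβ =>
      (hsic V hV β hβ).measurable_iInf (measurable_bellman hcm q β hV)
    iSup_mem := fun V hV => Measurable.iSup hV
    sub_mem := fun V hV r _ => Measurable.sub_const hV r
    exists_envelope := fun V hV => ⟨fun x => ⨅ n, V n x, Measurable.iInf hV,
      fun n x => iInf_le _ n, fun g _ hg x => le_iInf fun n => hg n x⟩ }

/-- `K`-inf-compactness of an extended nonnegative cost. -/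
def KInfCompact {X A : Type*} [TopologicalSpace X] [TopologicalSpace A] (f : X × A → ℝ≥0∞) :
    Prop :=
  ∀ K : Set X, IsCompact K → ∀ r : ℝ≥0∞, r ≠ ⊤ → IsCompact {p | p.1 ∈ K ∧ f p ≤ r}

lemma KInfCompact.sectionInfCompact {X A : Type*} [TopologicalSpace X] [T1Space X]
    [TopologicalSpace A] {f : X × A → ℝ≥0∞} (hf : KInfCompact f) : SectionInfCompact f := by
  intro x r hr
  have := (hf {x} isCompact_singleton r hr).image continuous_snd
  convert this using 1
  ext a
  constructor
  · exact fun h => ⟨(x, a), ⟨rfl, h⟩, rfl⟩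
  · rintro ⟨⟨x', a'⟩, ⟨h1, h2⟩, rfl⟩
    obtain rfl : x' = x := h1
    exact h2

lemma KInfCompact.lowerSemicontinuous {X A : Type*} [MetricSpace X] [MetricSpace A]
    {f : X × A → ℝ≥0∞} (hf : KInfCompact f) : LowerSemicontinuous f := by
  rw [lowerSemicontinuous_iff_isClosed_preimage]
  intro r
  by_cases hr : r = ⊤
  · simp [hr]
  refine IsSeqClosed.isClosed fun p p₀ hp hlim => ?_
  have hlim1 : Tendsto (fun n => (p n).1) atTop (𝓝 p₀.1) :=
    (continuous_fst.tendsto p₀).comp hlim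
  have hcl := (hf _ hlim1.isCompact_insert_range r hr).isClosed
  exact (hcl.mem_of_tendsto hlim (Eventually.of_forall fun n =>
    ⟨Or.inr ⟨n, rfl⟩, hp n⟩) : p₀ ∈ _).2

lemma KInfCompact.lowerSemicontinuous_iInf {X A : Type*} [MetricSpace X] [MetricSpace A]
    [Nonempty A] {f : X × A → ℝ≥0∞} (hf : KInfCompact f) :
    LowerSemicontinuous fun x => ⨅ a, f (x, a) := by
  rw [lowerSemicontinuous_iff_isClosed_preimage]
  intro r
  by_cases hr : r = ⊤
  · simp [hr]
  refine IsSeqClosed.isClosed fun x x₀ hx hlim => ?_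
  have hcl := ((hf _ hlim.isCompact_insert_range r hr).image continuous_fst).isClosed
  have : x₀ ∈ Prod.fst '' {p : X × A | p.1 ∈ insert x₀ (range x) ∧ f p ≤ r} := by
    refine hcl.mem_of_tendsto hlim (Eventually.of_forall fun n => ?_)
    obtain ⟨a, ha⟩ := hf.sectionInfCompact.exists_eq_iInf (x n)
    exact ⟨(x n, a), ⟨Or.inr ⟨n, rfl⟩, ha.trans_le (hx n)⟩, rfl⟩
  obtain ⟨⟨x', a⟩, ⟨-, h2⟩, rfl⟩ := this
  exact (iInf_le (fun a => f (x', a)) a).trans h2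

/-- Under weak continuity and `K`-inf-compactness, the lower semicontinuous functions form a value
class. -/
theorem isValueClass_lowerSemicontinuous [MetricSpace X] [BorelSpace X] [MetricSpace A] [Nonempty A]
    {c : X × A → ℝ≥0∞} (hc : KInfCompact c) {q : Kernel (X × A) X}
    [IsMarkovKernel q]
    (hq : ∀ f : BoundedContinuousFunction X ℝ, Continuous fun p => ∫ y, f y ∂q p) :
    IsValueClass c q {V | LowerSemicontinuous V} := by
  let Q : X × A → ProbabilityMeasure X := fun p => ⟨q p, inferInstance⟩
  have hqc : Continuous Q :=
    continuous_iff_continuousAt.2 fun p =>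
      ProbabilityMeasure.tendsto_iff_forall_integral_tendsto.2 fun f => (hq f).tendsto p
  have hInt : ∀ V : X → ℝ≥0∞, LowerSemicontinuous V →
      LowerSemicontinuous fun p => ∫⁻ y, V y ∂q p := fun V hV =>
    lowerSemicontinuous_lintegral_of_superlevel hV.measurable fun r => by
      rw [lowerSemicontinuous_iff_le_liminf]
      exact fun p => ProbabilityMeasure.le_liminf_measure_open_of_tendsto (hqc.tendsto p)
        (hV.isOpen_preimage r)
  have hK : ∀ V : X → ℝ≥0∞, LowerSemicontinuous V → ∀ β : ℝ≥0∞, β ≠ ⊤ →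
      KInfCompact (bellman c q β V) := by
    intro V hV β hβ K hKc r hr
    have hlsc : LowerSemicontinuous (bellman c q β V) :=
      hc.lowerSemicontinuous.add (Continuous.comp_lowerSemicontinuous
        (ENNReal.continuous_const_mul hβ) (hInt V hV) fun a b hab => by gcongr)
    refine (hc K hKc r hr).of_isClosed_subset ?_ fun p hp => ⟨hp.1, le_self_add.trans hp.2⟩
    exact (hKc.isClosed.preimage continuous_fst).inter
      (lowerSemicontinuous_iff_isClosed_preimage.1 hlsc r)
  exact
  { zero_mem := lowerSemicontinuous_const
    measurable := fun V hV => LowerSemicontinuous.measurable hV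
    sectionInfCompact := fun V hV β hβ => (hK V hV β hβ).sectionInfCompact
    iInf_bellman_mem := fun V hV β hβ => (hK V hV β hβ).lowerSemicontinuous_iInf
    iSup_mem := fun V hV => lowerSemicontinuous_iSup hV
    sub_mem := fun V hV r hr => Continuous.comp_lowerSemicontinuous
      (ENNReal.continuous_sub_right r) hV fun a b hab => tsub_le_tsub_right hab r
    exists_envelope := fun V hV => ⟨fun x => ⨆ g : {g : X → ℝ≥0∞ // LowerSemicontinuous g ∧
        ∀ n, g ≤ V n}, g.1 x, lowerSemicontinuous_iSup fun g => g.2.1,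
      fun n x => iSup_le fun g => g.2.2 n x,
      fun g hg hgV x => le_iSup (fun g : {g : X → ℝ≥0∞ // LowerSemicontinuous g ∧
        ∀ n, g ≤ V n} => g.1 x) ⟨g, hg, hgV⟩⟩ }

end ValueClass

section History

lemma ProbabilityTheory.Kernel.measurable_map_prodMk {T Y Z : Type*} [MeasurableSpace T]
    [MeasurableSpace Y] [MeasurableSpace Z] (κ : Kernel T Y) [IsSFiniteKernel κ] {F : T × Y → Z}
    (hF : Measurable F) : Measurable fun t => (κ t).map fun y => F (t, y) := by
  refine Measure.measurable_of_measurable_coe _ fun s hs => ?_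
  have : ∀ t, (κ t).map (fun y => F (t, y)) s = κ t (Prod.mk t ⁻¹' (F ⁻¹' s)) := fun t =>
    Measure.map_apply (hF.comp measurable_prodMk_left) hs
  simp_rw [this]
  exact Kernel.measurable_kernel_prodMk_left (hF hs)

lemma ProbabilityTheory.Kernel.measurable_bind_prodMk {T Y Z : Type*} [MeasurableSpace T]
    [MeasurableSpace Y] [MeasurableSpace Z] (κ : Kernel T Y) [IsSFiniteKernel κ]
    {g : T × Y → Measure Z} (hg : Measurable g) :
    Measurable fun t => (κ t).bind fun y => g (t, y) := by
  refine Measure.measurable_of_measurable_coe _ fun s hs => ?_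
  have : ∀ t, (κ t).bind (fun y => g (t, y)) s = ∫⁻ y, g (t, y) s ∂κ t := fun t =>
    Measure.bind_apply hs (hg.comp measurable_prodMk_left).aemeasurable
  simp_rw [this]
  exact ((Measure.measurable_coe hs).comp hg).lintegral_kernel_prod_right'

variable {X A : Type*} [MeasurableSpace X] [MeasurableSpace A]

lemma measurable_snoc_hist (t : ℕ) :
    Measurable fun z : (Hist X A t × A) × X =>
      ((Fin.snoc z.1.1.1 (z.1.1.2, z.1.2), z.2) : Hist X A (t + 1)) := by
  refine Measurable.prodMk (measurable_pi_lambda _ fun i => ?_) measurable_snd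
  refine Fin.lastCases ?_ (fun i => ?_) i
  · simp only [Fin.snoc_last]
    fun_prop
  · simp only [Fin.snoc_castSucc]
    fun_prop

variable (M : MDP X A) (p : Policy X A)

instance (t : ℕ) : IsMarkovKernel (p.π t) := p.markov t

instance : IsMarkovKernel M.q := M.markov

lemma measurable_map_snoc_hist (t : ℕ) :
    Measurable fun z : Hist X A t × A => (M.q (z.1.2, z.2)).map fun x' =>
      ((Fin.snoc z.1.1 (z.1.2, z.2), x') : Hist X A (t + 1)) := by
  have hg : Measurable fun z : Hist X A t × A => (z.1.2, z.2) := by fun_prop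
  have := (M.q.comap _ hg).measurable_map_prodMk (measurable_snoc_hist (X := X) (A := A) t)
  simpa only [Kernel.comap_apply] using this

lemma measurable_histMeas_step (t : ℕ) :
    Measurable fun h : Hist X A t => ((p.π t) h).bind fun a =>
      (M.q (h.2, a)).map fun x' => ((Fin.snoc h.1 (h.2, a), x') : Hist X A (t + 1)) := by
  have := (p.π t).measurable_bind_prodMk (measurable_map_snoc_hist M t)
  exact this

lemma measurable_saMeas_step (t : ℕ) :
    Measurable fun h : Hist X A t => ((p.π t) h).map fun a => (h.2, a) :=
  (p.π t).measurable_map_prodMk (F := fun z : Hist X A t × A => (z.1.2, z.2)) (by fun_prop)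

lemma lintegral_histMeas_zero (x : X) {V : X → ℝ≥0∞} (hV : Measurable V) :
    ∫⁻ h, V h.2 ∂histMeas M p x 0 = V x :=
  lintegral_dirac' _ (hV.comp measurable_snd)

lemma lintegral_histMeas_succ (x : X) (t : ℕ) {V : X → ℝ≥0∞} (hV : Measurable V) :
    ∫⁻ h, V h.2 ∂histMeas M p x (t + 1) =
      ∫⁻ h, ∫⁻ a, ∫⁻ y, V y ∂M.q (h.2, a) ∂p.π t h ∂histMeas M p x t := by
  have hV2 : Measurable fun h : Hist X A (t + 1) => V h.2 := hV.comp measurable_snd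
  rw [histMeas, Measure.lintegral_bind (measurable_histMeas_step M p t).aemeasurable
    hV2.aemeasurable]
  refine lintegral_congr fun h => ?_
  have hm : Measurable fun a => (M.q (h.2, a)).map fun x' =>
      ((Fin.snoc h.1 (h.2, a), x') : Hist X A (t + 1)) :=
    (measurable_map_snoc_hist M t).comp (measurable_prodMk_left (x := h))
  rw [Measure.lintegral_bind hm.aemeasurable hV2.aemeasurable]
  refine lintegral_congr fun a => ?_
  have hs : Measurable fun x' => ((Fin.snoc h.1 (h.2, a), x') : Hist X A (t + 1)) :=
    (measurable_snoc_hist t).comp (measurable_prodMk_left (x := (h, a)))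
  rw [lintegral_map hV2 hs]

lemma lintegral_saMeas (x : X) (t : ℕ) {f : X × A → ℝ≥0∞} (hf : Measurable f) :
    ∫⁻ z, f z ∂saMeas M p x t = ∫⁻ h, ∫⁻ a, f (h.2, a) ∂p.π t h ∂histMeas M p x t := by
  rw [saMeas, Measure.lintegral_bind (measurable_saMeas_step p t).aemeasurable hf.aemeasurable]
  exact lintegral_congr fun h => lintegral_map hf measurable_prodMk_left

instance isProbabilityMeasure_histMeas (x : X) (t : ℕ) :
    IsProbabilityMeasure (histMeas M p x t) := by
  constructor
  induction t with
  | zero =>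
    have := lintegral_histMeas_zero M p x (V := fun _ => 1) measurable_const
    simpa using this
  | succ t ih =>
    have := lintegral_histMeas_succ M p x t (V := fun _ => 1) measurable_const
    simpa [ih] using this

instance isProbabilityMeasure_saMeas (x : X) (t : ℕ) :
    IsProbabilityMeasure (saMeas M p x t) := by
  constructor
  have := lintegral_saMeas M p x t (f := fun _ => 1) measurable_const
  simpa using this

lemma lintegral_bellman_hist {c : X × A → ℝ≥0∞} (hc : Measurable c) (β : ℝ≥0∞) {V : X → ℝ≥0∞}
    (hV : Measurable V) (x : X) (t : ℕ) :
    ∫⁻ h, ∫⁻ a, bellman c M.q β V (h.2, a) ∂p.π t h ∂histMeas M p x t =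
      ∫⁻ z, c z ∂saMeas M p x t + β * ∫⁻ h, V h.2 ∂histMeas M p x (t + 1) := by
  have hb := measurable_bellman hc M.q β hV
  have hInt : Measurable fun z => ∫⁻ y, V y ∂M.q z := hV.lintegral_kernel
  rw [← lintegral_saMeas M p x t hb, lintegral_histMeas_succ M p x t hV,
    ← lintegral_saMeas M p x t hInt, ← lintegral_const_mul _ hInt, ← lintegral_add_left hc]
  rfl

/-- The total discounted cost of a nonnegative cost function. -/
def discCost (c : X × A → ℝ≥0∞) (β : ℝ≥0∞) (x : X) : ℝ≥0∞ :=
  ∑' t, β ^ t * ∫⁻ z, c z ∂saMeas M p x t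

/-- Value iteration started from zero. -/
def valueIter {X A : Type*} [MeasurableSpace X] [MeasurableSpace A] (c : X × A → ℝ≥0∞)
    (q : Kernel (X × A) X) (β : ℝ≥0∞) : ℕ → X → ℝ≥0∞
  | 0 => fun _ => 0
  | n + 1 => fun x => ⨅ a, bellman c q β (valueIter c q β n) (x, a)

lemma monotone_valueIter (c : X × A → ℝ≥0∞) (q : Kernel (X × A) X) (β : ℝ≥0∞) :
    Monotone (valueIter c q β) := by
  refine monotone_nat_of_le_succ fun n => ?_
  induction n with
  | zero => exact fun x => zero_le
  | succ n ih => exact fun x => iInf_mono fun a => bellman_mono c q le_rfl ih (x, a)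

lemma valueIter_le_discCost {c : X × A → ℝ≥0∞} (hc : Measurable c) {β : ℝ≥0∞}
    (hm : ∀ n, Measurable (valueIter c M.q β n)) (n : ℕ) (x : X) :
    valueIter c M.q β n x ≤ discCost M p c β x := by
  have key : ∀ n t, ∫⁻ h, valueIter c M.q β n h.2 ∂histMeas M p x t ≤
      ∑ i ∈ Finset.range n, β ^ i * ∫⁻ z, c z ∂saMeas M p x (t + i) := by
    intro n
    induction n with
    | zero => simp [valueIter]
    | succ n ih =>
      intro t
      calc ∫⁻ h, valueIter c M.q β (n + 1) h.2 ∂histMeas M p x t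
          ≤ ∫⁻ h, ∫⁻ a, bellman c M.q β (valueIter c M.q β n) (h.2, a) ∂p.π t h
              ∂histMeas M p x t := by
            refine lintegral_mono fun h => ?_
            have : valueIter c M.q β (n + 1) h.2 =
                ∫⁻ _, valueIter c M.q β (n + 1) h.2 ∂p.π t h := by simp
            rw [this]
            exact lintegral_mono fun a => iInf_le _ a
        _ = ∫⁻ z, c z ∂saMeas M p x t +
              β * ∫⁻ h, valueIter c M.q β n h.2 ∂histMeas M p x (t + 1) :=
            lintegral_bellman_hist M p hc β (hm n) x t
        _ ≤ ∫⁻ z, c z ∂saMeas M p x t +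
              β * ∑ i ∈ Finset.range n, β ^ i * ∫⁻ z, c z ∂saMeas M p x (t + 1 + i) := by
            gcongr
            exact ih (t + 1)
        _ = ∑ i ∈ Finset.range (n + 1), β ^ i * ∫⁻ z, c z ∂saMeas M p x (t + i) := by
            rw [Finset.sum_range_succ', Finset.mul_sum, add_comm]
            simp only [pow_zero, one_mul, add_zero]
            congr 1
            refine Finset.sum_congr rfl fun i _ => ?_
            rw [pow_succ', mul_assoc, add_assoc, add_comm 1 i]
  have := key n 0
  rw [lintegral_histMeas_zero M p x (hm n)] at this
  refine this.trans ?_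
  simp only [zero_add]
  exact ENNReal.sum_le_tsum _

lemma discCost_detPolicy_le {c : X × A → ℝ≥0∞} (hc : Measurable c) {β : ℝ≥0∞} {V : X → ℝ≥0∞}
    (hV : Measurable V) {φ : X → A} (hφ : Measurable φ)
    (h : ∀ x, bellman c M.q β V (x, φ x) ≤ V x) (x : X) :
    discCost M (detPolicy φ hφ) c β x ≤ V x := by
  set p := detPolicy φ hφ
  have hb := measurable_bellman hc M.q β hV
  have key : ∀ n t, ∑ i ∈ Finset.range n, β ^ i * ∫⁻ z, c z ∂saMeas M p x (t + i) ≤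
      ∫⁻ h, V h.2 ∂histMeas M p x t := by
    intro n
    induction n with
    | zero => simp
    | succ n ih =>
      intro t
      calc ∑ i ∈ Finset.range (n + 1), β ^ i * ∫⁻ z, c z ∂saMeas M p x (t + i)
          = ∫⁻ z, c z ∂saMeas M p x t +
              β * ∑ i ∈ Finset.range n, β ^ i * ∫⁻ z, c z ∂saMeas M p x (t + 1 + i) := by
            rw [Finset.sum_range_succ', Finset.mul_sum, add_comm]
            simp only [pow_zero, one_mul, add_zero]
            congr 1
            refine Finset.sum_congr rfl fun i _ => ?_
            rw [pow_succ', mul_assoc, add_assoc, add_comm 1 i]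
        _ ≤ ∫⁻ z, c z ∂saMeas M p x t + β * ∫⁻ h, V h.2 ∂histMeas M p x (t + 1) := by
            gcongr
            exact ih (t + 1)
        _ = ∫⁻ h, ∫⁻ a, bellman c M.q β V (h.2, a) ∂p.π t h ∂histMeas M p x t :=
            (lintegral_bellman_hist M p hc β hV x t).symm
        _ ≤ ∫⁻ h, V h.2 ∂histMeas M p x t := by
            refine lintegral_mono fun g => ?_
            have : ∫⁻ a, bellman c M.q β V (g.2, a) ∂p.π t g =
                bellman c M.q β V (g.2, φ g.2) :=
              lintegral_dirac' _ (hb.comp measurable_prodMk_left)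
            rw [this]
            exact h g.2
  refine ENNReal.tsum_le_of_sum_range_le fun n => ?_
  have := key n 0
  rw [lintegral_histMeas_zero M p x hV] at this
  simpa only [zero_add] using this

/-- The discounted value function belongs to the value class and satisfies the optimality
equation. -/
theorem IsValueClass.iInf_discCost [StandardBorelSpace X] [MetricSpace A]
    [TopologicalSpace.SeparableSpace A] [BorelSpace A] [StandardBorelSpace A] [Nonempty A]
    {M : MDP X A} {c : X × A → ℝ≥0∞} (hc : Measurable c) {L : Set (X → ℝ≥0∞)}
    (hL : IsValueClass c M.q L) {β : ℝ≥0∞} (hβ : β ≠ ⊤) :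
    (fun x => ⨅ p, discCost M p c β x) ∈ L ∧
      ∀ x, ⨅ a, bellman c M.q β (fun x => ⨅ p, discCost M p c β x) (x, a) =
        ⨅ p, discCost M p c β x := by
  have hmem : ∀ n, valueIter c M.q β n ∈ L := by
    intro n
    induction n with
    | zero => exact hL.zero_mem
    | succ n ih => exact hL.iInf_bellman_mem _ ih β hβ
  have hm : ∀ n, Measurable (valueIter c M.q β n) := fun n => hL.measurable _ (hmem n)
  have hmono := monotone_valueIter c M.q β
  let V : X → ℝ≥0∞ := fun x => ⨆ n, valueIter c M.q β n x
  have hVL : V ∈ L := hL.iSup_mem _ hmem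
  have hVm : Measurable V := hL.measurable V hVL
  have hfix : ∀ x, ⨅ a, bellman c M.q β V (x, a) = V x := by
    intro x
    have h1 := SectionInfCompact.iSup_iInf_eq
      (f := fun n => bellman c M.q β (valueIter c M.q β n))
      (fun n => hL.sectionInfCompact _ (hmem n) β hβ)
      (fun m n h => bellman_mono c M.q le_rfl (hmono h)) x
    have h2 := fun a => iSup_bellman c M.q (β := fun _ => β) monotone_const hm hmono (x, a)
    simp only [ciSup_const] at h2
    simp only [h2] at h1
    rw [← h1]
    refine le_antisymm (iSup_le fun n => le_iSup (fun n => valueIter c M.q β n x) (n + 1))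
      (iSup_le fun n => ?_)
    exact (hmono (Nat.le_succ n) x).trans
      (le_iSup (fun n => ⨅ a, bellman c M.q β (valueIter c M.q β n) (x, a)) n)
  have hV : (fun x => ⨅ p, discCost M p c β x) = V := by
    funext x
    refine le_antisymm ?_ (iSup_le fun n => le_iInf fun p => valueIter_le_discCost M p hc hm n x)
    obtain ⟨φ, hφ, hsel⟩ := (hL.sectionInfCompact V hVL β hβ).exists_measurable_eq_iInf
      (measurable_bellman hc M.q β hVm)
    exact (iInf_le _ (detPolicy φ hφ)).trans (discCost_detPolicy_le M hc hVm hφ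
      (fun x => ((hsel x).trans (hfix x)).le) x)
  have hV' : ∀ x, ⨅ p, discCost M p c β x = V x := fun x => congrFun hV x
  rw [hV]
  exact ⟨hVL, fun x => by rw [hV', hfix]⟩

end History

section ExtendedReal

lemma eToENN_eq_toENNReal (x : EReal) : eToENN x = x.toENNReal := rfl

lemma eInt_eq_sub {Y : Type*} [MeasurableSpace Y] (μ : Measure Y) {f : Y → EReal}
    {g h : Y → ℝ≥0∞} (hg : Measurable g) (hh : Measurable h) (hfin : ∀ y, h y ≠ ⊤)
    (hInt : ∫⁻ y, h y ∂μ ≠ ⊤) (hf : ∀ y, f y = (g y : EReal) - (h y : EReal)) :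
    eInt μ f = ((∫⁻ y, g y ∂μ : ℝ≥0∞) : EReal) - ((∫⁻ y, h y ∂μ : ℝ≥0∞) : EReal) := by
  have hpos : ∀ y, eToENN (f y) = g y - h y := fun y => by
    rw [eToENN_eq_toENNReal, hf, EReal.toENNReal_sub (EReal.coe_ennreal_nonneg _)]
    simp
  have hneg : ∀ y, eToENN (-f y) = h y - g y := fun y => by
    have : -f y = (h y : EReal) - (g y : EReal) := by
      rw [hf, EReal.neg_sub (Or.inl (EReal.coe_ennreal_ne_bot _))
        (Or.inr (by simpa using hfin y)), add_comm, sub_eq_add_neg]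
    rw [eToENN_eq_toENNReal, this, EReal.toENNReal_sub (EReal.coe_ennreal_nonneg _)]
    simp
  have hsum : ∫⁻ y, (g y - h y) ∂μ + ∫⁻ y, h y ∂μ = ∫⁻ y, (h y - g y) ∂μ + ∫⁻ y, g y ∂μ := by
    rw [← lintegral_add_right _ hh, ← lintegral_add_right _ hg]
    refine lintegral_congr fun y => ?_
    rw [tsub_add_eq_max, tsub_add_eq_max, max_comm]
  have hN : ∫⁻ y, (h y - g y) ∂μ ≠ ⊤ :=
    ne_top_of_le_ne_top hInt (lintegral_mono fun y => tsub_le_self)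
  simp only [eInt, hpos, hneg]
  generalize ∫⁻ y, (g y - h y) ∂μ = P at hsum ⊢
  generalize ∫⁻ y, (h y - g y) ∂μ = N at hsum hN ⊢
  generalize ∫⁻ y, h y ∂μ = H at hsum hInt ⊢
  generalize ∫⁻ y, g y ∂μ = G at hsum ⊢
  lift N to ℝ≥0 using hN
  lift H to ℝ≥0 using hInt
  induction P with
  | top =>
    have : G = ⊤ := by
      have h1 : (N : ℝ≥0∞) + G = ⊤ := by rw [← hsum]; simp
      simpa using h1
    subst this
    rfl
  | coe P =>
    have hG : G ≠ ⊤ := by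
      intro h
      rw [h] at hsum
      simp at hsum
    lift G to ℝ≥0 using hG
    have h2 : (P : ℝ) + H = N + G := by exact_mod_cast hsum
    have h3 : (P : ℝ) - N = G - H := by linarith
    simp only [EReal.coe_nnreal_eq_coe_real]
    exact_mod_cast h3

lemma eSum_eq_sub {f : ℕ → EReal} {g h : ℕ → ℝ≥0∞} (hfin : ∀ t, h t ≠ ⊤)
    (hsum : ∑' t, h t ≠ ⊤) (hf : ∀ t, f t = (g t : EReal) - (h t : EReal)) :
    eSum f = ((∑' t, g t : ℝ≥0∞) : EReal) - ((∑' t, h t : ℝ≥0∞) : EReal) := by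
  have := eInt_eq_sub (Measure.count (α := ℕ)) (f := f) (g := g) (h := h) (by fun_prop)
    (by fun_prop) hfin (by rwa [lintegral_count]) hf
  simpa only [eSum, eInt, lintegral_count] using this

lemma coe_mul_coe_sub {r k : ℝ} (hr : 0 ≤ r) (hk : 0 ≤ k) (x : ℝ≥0∞) :
    (r : EReal) * ((x : EReal) - (k : EReal)) =
      ((ENNReal.ofReal r * x : ℝ≥0∞) : EReal) - ((ENNReal.ofReal (r * k) : ℝ≥0∞) : EReal) := by
  rw [EReal.coe_ennreal_ofReal, max_eq_left (mul_nonneg hr hk)]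
  induction x with
  | top =>
    rcases hr.eq_or_lt with rfl | hr'
    · simp
    · rw [ENNReal.mul_top (by simpa using hr'), EReal.coe_ennreal_top, EReal.top_sub_coe,
        EReal.top_sub_coe, EReal.coe_mul_top_of_pos hr']
  | coe x =>
    rw [EReal.coe_ennreal_mul, EReal.coe_ennreal_ofReal, max_eq_left hr]
    have : r * ((x : ℝ) - k) = r * x - r * k := mul_sub _ _ _
    rw [EReal.coe_nnreal_eq_coe_real]
    exact_mod_cast this

lemma coe_iInf_sub {ι : Sort*} (f : ι → ℝ≥0∞) (k : ℝ) :
    (((⨅ i, f i : ℝ≥0∞) : EReal) - (k : EReal)) = ⨅ i, ((f i : EReal) - (k : EReal)) := by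
  have hc : Continuous fun z : ℝ≥0∞ => (z : EReal) - (k : EReal) := by
    refine continuous_iff_continuousAt.2 fun z => ?_
    have h1 : ContinuousAt (fun p : EReal × EReal => p.1 + p.2) ((z : EReal), ((-k : ℝ) : EReal)) :=
      EReal.continuousAt_add (Or.inr (EReal.coe_ne_bot _)) (Or.inr (EReal.coe_ne_top _))
    exact ContinuousAt.comp (f := fun z : ℝ≥0∞ => ((z : EReal), ((-k : ℝ) : EReal))) h1
      (continuous_coe_ennreal_ereal.prodMk continuous_const).continuousAt
  exact Monotone.map_iInf_of_continuousAt (f := fun z : ℝ≥0∞ => (z : EReal) - (k : EReal))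
    hc.continuousAt
    (fun a b hab => EReal.sub_le_sub (by exact_mod_cast hab) le_rfl) (by simp)

end ExtendedReal

section ShiftedCost

variable {X A : Type*} [MeasurableSpace X] [MeasurableSpace A] (M : MDP X A) (k : ℝ)

/-- The one-step cost shifted by a constant that makes it nonnegative. -/
def shiftCost (p : X × A) : ℝ≥0∞ := (M.c p.1 p.2 + (k : EReal)).toENNReal

lemma measurable_shiftCost : Measurable (shiftCost M k) := by
  have h := M.c_meas
  exact (h.add_const (k : EReal)).ereal_toENNReal

variable {M k}

lemma cost_eq_shiftCost_sub (hM : ∀ x a, ((-k : ℝ) : EReal) ≤ M.c x a)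
    (p : X × A) :
    M.c p.1 p.2 = (shiftCost M k p : EReal) - (k : EReal) := by
  have h0 : 0 ≤ M.c p.1 p.2 + (k : EReal) := by
    have := add_le_add_left (hM p.1 p.2) (k : EReal)
    refine le_trans (le_of_eq ?_) this
    rw [← EReal.coe_add]
    simp
  rw [shiftCost, EReal.coe_toENNReal h0, EReal.add_sub_cancel_right]

lemma shiftCost_le_iff (hM : ∀ x a, ((-k : ℝ) : EReal) ≤ M.c x a)
    (p : X × A) {r : ℝ≥0∞} (hr : r ≠ ⊤) :
    shiftCost M k p ≤ r ↔ M.c p.1 p.2 ≤ ((r.toReal - k : ℝ) : EReal) := by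
  lift r to ℝ≥0 using hr
  rw [cost_eq_shiftCost_sub hM, EReal.sub_le_iff_le_add (Or.inl (EReal.coe_ne_bot _))
    (Or.inl (EReal.coe_ne_top _)), ← EReal.coe_add, sub_add_cancel]
  exact EReal.coe_ennreal_le_coe_ennreal_iff.symm

lemma expCost_eq (hM : ∀ x a, ((-k : ℝ) : EReal) ≤ M.c x a)
    (hk : 0 ≤ k) (p : Policy X A) (x : X) (t : ℕ) :
    expCost M p x t =
      ((∫⁻ z, shiftCost M k z ∂saMeas M p x t : ℝ≥0∞) : EReal) - (k : EReal) := by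
  have := eInt_eq_sub (saMeas M p x t) (f := fun z => M.c z.1 z.2) (measurable_shiftCost M k)
    (h := fun _ => ENNReal.ofReal k) measurable_const (by simp) (by simp) (fun z => by
      rw [cost_eq_shiftCost_sub hM, EReal.coe_ennreal_ofReal, max_eq_left hk])
  rw [expCost, this]
  simp [EReal.coe_ennreal_ofReal, max_eq_left hk]

lemma vDisc_eq (hM : ∀ x a, ((-k : ℝ) : EReal) ≤ M.c x a)
    (hk : 0 ≤ k) {α : ℝ} (h0 : 0 ≤ α) (h1 : α < 1) (p : Policy X A) (x : X) :
    vDisc M α p x =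
      (discCost M p (shiftCost M k) (ENNReal.ofReal α) x : EReal) -
        ((k / (1 - α) : ℝ) : EReal) := by
  have hs := (summable_geometric_of_lt_one h0 h1).mul_right k
  have hsum : ∑' t, ENNReal.ofReal (α ^ t * k) = ENNReal.ofReal (k / (1 - α)) := by
    rw [← ENNReal.ofReal_tsum_of_nonneg (fun t => by positivity) hs, tsum_mul_right,
      tsum_geometric_of_lt_one h0 h1, div_eq_inv_mul]
  have hterm := fun t => coe_mul_coe_sub (pow_nonneg h0 t) hk
    (∫⁻ z, shiftCost M k z ∂saMeas M p x t)
  rw [vDisc, eSum_eq_sub (g := fun t => ENNReal.ofReal (α ^ t) *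
    ∫⁻ z, shiftCost M k z ∂saMeas M p x t) (h := fun t => ENNReal.ofReal (α ^ t * k))
    (by simp) (by simp [hsum]) (fun t => by rw [expCost_eq hM hk, hterm]), hsum,
    EReal.coe_ennreal_ofReal, max_eq_left (div_nonneg hk (by linarith))]
  simp only [discCost, ENNReal.ofReal_pow h0]

lemma vDiscOpt_eq (hM : ∀ x a, ((-k : ℝ) : EReal) ≤ M.c x a)
    (hk : 0 ≤ k) {α : ℝ} (h0 : 0 ≤ α) (h1 : α < 1) (x : X) :
    vDiscOpt M α x = ((⨅ p, discCost M p (shiftCost M k) (ENNReal.ofReal α) x : ℝ≥0∞) : EReal) -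
      ((k / (1 - α) : ℝ) : EReal) := by
  simp only [vDiscOpt, vDisc_eq hM hk h0 h1, coe_iInf_sub]

lemma mDisc_eq (hM : ∀ x a, ((-k : ℝ) : EReal) ≤ M.c x a)
    (hk : 0 ≤ k) {α : ℝ} (h0 : 0 ≤ α) (h1 : α < 1) :
    mDisc M α = ((⨅ x, ⨅ p, discCost M p (shiftCost M k) (ENNReal.ofReal α) x : ℝ≥0∞) : EReal) -
      ((k / (1 - α) : ℝ) : EReal) := by
  simp only [mDisc, vDiscOpt_eq hM hk h0 h1, coe_iInf_sub]

lemma one_sub_mul_mDisc_eq (hM : ∀ x a, ((-k : ℝ) : EReal) ≤ M.c x a)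
    (hk : 0 ≤ k) {α : ℝ} (h0 : 0 ≤ α) (h1 : α < 1) :
    ((1 - α : ℝ) : EReal) * mDisc M α =
      ((ENNReal.ofReal (1 - α) * ⨅ x, ⨅ p, discCost M p (shiftCost M k) (ENNReal.ofReal α) x :
        ℝ≥0∞) : EReal) - (k : EReal) := by
  have h2 : 0 < 1 - α := by linarith
  rw [mDisc_eq hM hk h0 h1, coe_mul_coe_sub h2.le (div_nonneg hk h2.le), EReal.coe_ennreal_ofReal,
    mul_div_cancel₀ _ h2.ne', max_eq_left hk]

lemma uDisc_eq (hM : ∀ x a, ((-k : ℝ) : EReal) ≤ M.c x a)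
    (hk : 0 ≤ k) {α : ℝ} (h0 : 0 ≤ α) (h1 : α < 1)
    (hfin : ⨅ x, ⨅ p, discCost M p (shiftCost M k) (ENNReal.ofReal α) x ≠ ⊤) (x : X) :
    uDisc M α x = (((⨅ p, discCost M p (shiftCost M k) (ENNReal.ofReal α) x) -
      ⨅ x, ⨅ p, discCost M p (shiftCost M k) (ENNReal.ofReal α) x : ℝ≥0∞) : EReal) := by
  rw [uDisc, vDiscOpt_eq hM hk h0 h1, mDisc_eq hM hk h0 h1]
  have hle := iInf_le (fun x => ⨅ p, discCost M p (shiftCost M k) (ENNReal.ofReal α) x) x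
  generalize ⨅ x, ⨅ p, discCost M p (shiftCost M k) (ENNReal.ofReal α) x = m at *
  generalize ⨅ p, discCost M p (shiftCost M k) (ENNReal.ofReal α) x = v at *
  lift m to ℝ≥0 using hfin
  induction v with
  | top =>
    rw [ENNReal.top_sub_coe, EReal.coe_ennreal_top, EReal.top_sub_coe]
    exact EReal.top_sub_coe ((m : ℝ) - k / (1 - α))
  | coe v =>
    have hle' : m ≤ v := by exact_mod_cast hle
    have h3 : ((v : ℝ) - k / (1 - α)) - ((m : ℝ) - k / (1 - α)) = ((v - m : ℝ≥0) : ℝ) := by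
      rw [NNReal.coe_sub hle']; ring
    rw [← ENNReal.coe_sub]
    simp only [EReal.coe_nnreal_eq_coe_real]
    exact_mod_cast h3

end ShiftedCost

section VanishingDiscount

variable {X A : Type*} [MeasurableSpace X] [MeasurableSpace A]

theorem IsValueClass.exists_iInf_bellman_one_le [TopologicalSpace A] [T2Space A] [Nonempty A]
    {c : X × A → ℝ≥0∞} {q : Kernel (X × A) X} {L : Set (X → ℝ≥0∞)} (hL : IsValueClass c q L)
    {β : ℕ → ℝ≥0∞} (hβm : Monotone β) (hβt : ∀ n, β n ≠ ⊤) (hβ : ⨆ n, β n = 1)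
    {V : ℕ → X → ℝ≥0∞} (hV : ∀ n, V n ∈ L) {w : ℕ → ℝ≥0∞} {w' : ℝ≥0∞}
    (hw : Tendsto w atTop (𝓝 w')) (hw' : w' ≠ ⊤)
    (h : ∀ n x, ⨅ a, bellman c q (β n) (V n) (x, a) ≤ w n + V n x) :
    ∃ u ∈ L, (∀ x C, (∀ n, ∃ m ≥ n, V m x ≤ C) → u x ≤ C) ∧
      ∀ x, ⨅ a, bellman c q 1 u (x, a) ≤ w' + u x := by
  choose U hUL hUV hU using fun n => hL.exists_envelope (fun m => V (n + m)) fun m => hV (n + m)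
  have hUV' : ∀ {n m}, n ≤ m → U n ≤ V m := fun {n m} hnm => by
    obtain ⟨j, rfl⟩ := Nat.exists_eq_add_of_le hnm
    exact hUV n j
  have hUmono : Monotone U := fun m n hmn =>
    hU n (U m) (hUL m) fun j => hUV' (hmn.trans (Nat.le_add_right n j))
  have hUm : ∀ n, Measurable (U n) := fun n => hL.measurable _ (hUL n)
  refine ⟨fun x => ⨆ n, U n x, hL.iSup_mem _ hUL, fun x C hC => iSup_le fun n => ?_, fun x => ?_⟩
  · obtain ⟨m, hnm, hm⟩ := hC n
    exact (hUV' hnm x).trans hm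
  refine ENNReal.le_of_forall_pos_le_add fun ε hε _ => ?_
  have hlt : w' < w' + ε := ENNReal.lt_add_right hw' (by exact_mod_cast hε.ne')
  obtain ⟨N, hN⟩ := eventually_atTop.1 (hw.eventually_le_const hlt)
  have hbound : ∀ n ≥ N, ⨅ a, bellman c q (β n) (U n) (x, a) ≤ w' + ε + U n x := by
    intro n hn
    have hmem := hL.sub_mem _ (hL.iInf_bellman_mem (U n) (hUL n) (β n) (hβt n)) (w' + ε)
      (by simp [hw'])
    have := hU n _ hmem (fun j x => by
      refine tsub_le_iff_left.2 ?_
      calc ⨅ a, bellman c q (β n) (U n) (x, a)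
          ≤ ⨅ a, bellman c q (β (n + j)) (V (n + j)) (x, a) :=
            iInf_mono fun a => bellman_mono c q (hβm (Nat.le_add_right n j)) (hUV n j) (x, a)
        _ ≤ w (n + j) + V (n + j) x := h (n + j) x
        _ ≤ w' + ε + V (n + j) x := by
            gcongr
            exact hN (n + j) (by omega)) x
    exact tsub_le_iff_left.1 this
  have h1 := SectionInfCompact.iSup_iInf_eq (f := fun n => bellman c q (β n) (U n))
    (fun n => hL.sectionInfCompact _ (hUL n) _ (hβt n))
    (fun m n hmn => bellman_mono c q (hβm hmn) (hUmono hmn)) x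
  simp only [fun a => iSup_bellman c q hβm hUm hUmono (x, a), hβ] at h1
  rw [← h1]
  refine iSup_le fun n => ?_
  calc ⨅ a, bellman c q (β n) (U n) (x, a)
      ≤ ⨅ a, bellman c q (β (max n N)) (U (max n N)) (x, a) :=
        iInf_mono fun a => bellman_mono c q (hβm (le_max_left n N)) (hUmono (le_max_left n N)) _
    _ ≤ w' + ε + U (max n N) x := hbound _ (le_max_right n N)
    _ ≤ w' + ε + ⨆ n, U n x := by
        gcongr
        exact le_iSup (fun n => U n x) (max n N)
    _ = w' + (⨆ n, U n x) + ε := add_right_comm _ _ _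

lemma iInf_bellman_sub_iInf_le {c : X × A → ℝ≥0∞} {q : Kernel (X × A) X} [IsMarkovKernel q]
    {β : ℝ≥0∞} (hβ : β ≤ 1) {V : X → ℝ≥0∞} {m : ℝ≥0∞} (hm : m ≠ ⊤)
    (hmV : ∀ x, m ≤ V x) {x : X} (hV : ⨅ a, bellman c q β V (x, a) = V x) :
    ⨅ a, bellman c q β (fun y => V y - m) (x, a) ≤ (1 - β) * m + (V x - m) := by
  have hb : ∀ a, bellman c q β V (x, a) = bellman c q β (fun y => V y - m) (x, a) + β * m := by
    intro a
    have : ∫⁻ y, V y ∂q (x, a) = ∫⁻ y, (V y - m) ∂q (x, a) + m := by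
      calc ∫⁻ y, V y ∂q (x, a) = ∫⁻ y, (V y - m + m) ∂q (x, a) :=
            lintegral_congr fun y => (tsub_add_cancel_of_le (hmV y)).symm
        _ = _ := by rw [lintegral_add_right _ measurable_const]; simp
    simp only [bellman, this, mul_add, add_assoc]
  simp only [hb, ← ENNReal.iInf_add] at hV
  have hβm : β * m ≠ ⊤ := ENNReal.mul_ne_top (ne_top_of_le_ne_top ENNReal.one_ne_top hβ) hm
  refine (ENNReal.add_le_add_iff_right hβm).1 (hV.le.trans (le_of_eq ?_))
  calc V x = (V x - m) + m := (tsub_add_cancel_of_le (hmV x)).symm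
    _ = (V x - m) + ((1 - β) + β) * m := by rw [tsub_add_cancel_of_le hβ, one_mul]
    _ = _ := by ring

end VanishingDiscount

section OptimalityInequality

variable {X A : Type*} [MeasurableSpace X] [MeasurableSpace A]

lemma kInfCompact_shiftCost [MetricSpace X] [TopologicalSpace.SeparableSpace X] [BorelSpace X]
    [StandardBorelSpace X] [MetricSpace A] [TopologicalSpace.SeparableSpace A] [BorelSpace A]
    [StandardBorelSpace A] {M : MDP X A} {k : ℝ} (hM : ∀ x a, ((-k : ℝ) : EReal) ≤ M.c x a)
    (h : AssumptionWi M) : KInfCompact (shiftCost M k) := by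
  intro K hK r hr
  simp only [shiftCost_le_iff hM _ hr]
  rcases K.eq_empty_or_nonempty with rfl | hne
  · simp
  · exact h K hne hK _

lemma sectionInfCompact_shiftCost [MetricSpace X] [TopologicalSpace.SeparableSpace X]
    [BorelSpace X] [StandardBorelSpace X] [MetricSpace A] [TopologicalSpace.SeparableSpace A]
    [BorelSpace A] [StandardBorelSpace A] {M : MDP X A} {k : ℝ}
    (hM : ∀ x a, ((-k : ℝ) : EReal) ≤ M.c x a) (h : AssumptionSi M) :
    SectionInfCompact (shiftCost M k) := by
  intro x r hr
  simp only [shiftCost_le_iff hM _ hr]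
  exact h x _

theorem IsValueClass.exists_acoi [StandardBorelSpace X] [MetricSpace A]
    [TopologicalSpace.SeparableSpace A] [BorelSpace A] [StandardBorelSpace A] [Nonempty A]
    {M : MDP X A} {k : ℝ} (hk : 0 ≤ k) (hM : ∀ x a, ((-k : ℝ) : EReal) ≤ M.c x a)
    {L : Set (X → ℝ≥0∞)} (hL : IsValueClass (shiftCost M k) M.q L) {a : ℕ → ℝ}
    (ha : ∀ n, a n ∈ Set.Ico (0 : ℝ) 1) (hamono : Monotone a)
    (hatend : Tendsto a atTop (𝓝 (1 : ℝ)))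
    (hB : ∀ x, Filter.liminf (fun n => uDisc M (a n) x) atTop < ⊤) {w : EReal}
    (hconv : Tendsto (fun n : ℕ => ((1 - a n : ℝ) : EReal) * mDisc M (a n)) atTop (𝓝 w))
    (hw : w ≠ ⊤) :
    ∃ (φ : X → A) (_ : Measurable φ) (u : X → ℝ),
      (∀ x, 0 ≤ u x) ∧ Measurable u
      ∧ ∀ x, M.c x (φ x)
          + ((∫⁻ y, ENNReal.ofReal (u y) ∂ (M.q (x, φ x)) : ℝ≥0∞) : EReal)
        ≤ w + (u x : EReal) := by
  let V : ℕ → X → ℝ≥0∞ := fun n x =>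
    ⨅ p, discCost M p (shiftCost M k) (ENNReal.ofReal (a n)) x
  let m : ℕ → ℝ≥0∞ := fun n => ⨅ x, V n x
  let b : ℕ → ℝ≥0∞ := fun n => ENNReal.ofReal (1 - a n) * m n
  have hb : ∀ n, ((1 - a n : ℝ) : EReal) * mDisc M (a n) = (b n : EReal) - (k : EReal) :=
    fun n => one_sub_mul_mDisc_eq hM hk (ha n).1 (ha n).2
  simp only [hb] at hconv
  have hconv' : Tendsto (fun n => (b n : EReal)) atTop (𝓝 (w + k)) := by
    have hc : ContinuousAt (fun p : EReal × EReal => p.1 + p.2) (w, (k : EReal)) :=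
      EReal.continuousAt_add (Or.inr (EReal.coe_ne_bot _)) (Or.inr (EReal.coe_ne_top _))
    have := hc.tendsto.comp (hconv.prodMk_nhds (tendsto_const_nhds (x := (k : EReal))))
    refine this.congr fun n => ?_
    exact EReal.sub_add_cancel
  have hwk : 0 ≤ w + k := ge_of_tendsto' hconv' fun n => EReal.coe_ennreal_nonneg _
  obtain ⟨w', hw'⟩ : ∃ w' : ℝ≥0∞, (w' : EReal) = w + k := ⟨_, EReal.coe_toENNReal hwk⟩
  have hweq : w = (w' : EReal) - (k : EReal) := by rw [hw', EReal.add_sub_cancel_right]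
  have hw't : w' ≠ ⊤ := by
    rintro rfl
    exact hw (by rw [hweq]; simp)
  have hbt : Tendsto b atTop (𝓝 w') := by
    rw [← hw'] at hconv'
    simpa [Function.comp_def] using (EReal.continuous_toENNReal.tendsto _).comp hconv'
  obtain ⟨N, hN⟩ := eventually_atTop.1 (hbt.eventually_lt_const (lt_top_iff_ne_top.2 hw't))
  have hmt : ∀ n ≥ N, m n ≠ ⊤ := by
    intro n hn htop
    have h1 : b n = ⊤ := by
      have : 0 < 1 - a n := by linarith [(ha n).2]
      simp only [b, htop]
      exact ENNReal.mul_top (by simpa using this)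
    exact (hN n hn).ne h1
  have hVL : ∀ n, V n ∈ L ∧ ∀ x, ⨅ c, bellman (shiftCost M k) M.q (ENNReal.ofReal (a n)) (V n)
      (x, c) = V n x := fun n =>
    hL.iInf_discCost (measurable_shiftCost M k) ENNReal.ofReal_ne_top
  have hβm : Monotone fun n => ENNReal.ofReal (a (n + N)) := fun i j hij =>
    ENNReal.ofReal_le_ofReal (hamono (by omega))
  have hβ : ⨆ n, ENNReal.ofReal (a (n + N)) = 1 := by
    refine iSup_eq_of_tendsto hβm ?_
    have := (ENNReal.tendsto_ofReal hatend).comp (tendsto_add_atTop_nat N)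
    simpa [Function.comp_def] using this
  obtain ⟨u, huL, hub, hu⟩ := hL.exists_iInf_bellman_one_le hβm (fun _ => ENNReal.ofReal_ne_top) hβ
    (V := fun n x => V (n + N) x - m (n + N))
    (fun n => hL.sub_mem _ (hVL _).1 _ (hmt _ (by omega)))
    (hbt.comp (tendsto_add_atTop_nat N)) hw't fun n x => by
      have := iInf_bellman_sub_iInf_le (β := ENNReal.ofReal (a (n + N)))
        (by simpa using (ha (n + N)).2.le) (hmt (n + N) (by omega))
        (fun x => iInf_le (V (n + N)) x) ((hVL (n + N)).2 x)
      refine this.trans (le_of_eq ?_)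
      simp only [b, Function.comp, ENNReal.ofReal_sub _ (ha (n + N)).1, ENNReal.ofReal_one]
  have hut : ∀ x, u x ≠ ⊤ := by
    intro x
    obtain ⟨C, hC, -⟩ := EReal.lt_iff_exists_real_btwn.1 (hB x)
    have hfr := frequently_lt_of_liminf_lt (by isBoundedDefault) hC
    refine ne_top_of_le_ne_top (ENNReal.ofReal_ne_top (r := C)) (hub x _ fun n => ?_)
    obtain ⟨j, hj, hjC⟩ := frequently_atTop.1 hfr (n + N)
    obtain ⟨i, rfl⟩ := Nat.exists_eq_add_of_le' (show N ≤ j by omega)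
    refine ⟨i, by omega, ?_⟩
    rw [uDisc_eq hM hk (ha _).1 (ha _).2 (hmt _ (by omega))] at hjC
    have : (((V (i + N) x - m (i + N) : ℝ≥0∞)) : EReal) ≤ (ENNReal.ofReal C : ℝ≥0∞) := by
      rw [EReal.coe_ennreal_ofReal]
      exact hjC.le.trans (by exact_mod_cast le_max_left C 0)
    exact EReal.coe_ennreal_le_coe_ennreal_iff.1 this
  have hum := hL.measurable u huL
  obtain ⟨φ, hφ, hsel⟩ :=
    (hL.sectionInfCompact u huL 1 ENNReal.one_ne_top).exists_measurable_eq_iInf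
    (measurable_bellman (measurable_shiftCost M k) M.q 1 hum)
  refine ⟨φ, hφ, fun x => (u x).toReal, fun x => ENNReal.toReal_nonneg, hum.ennreal_toReal,
    fun x => ?_⟩
  have hx := (hsel x).trans_le (hu x)
  simp only [bellman, one_mul] at hx
  have hx' : (shiftCost M k (x, φ x) : EReal) + ((∫⁻ y, u y ∂M.q (x, φ x) : ℝ≥0∞) : EReal) ≤
      (w' : EReal) + (u x : EReal) := by exact_mod_cast hx
  simp only [fun y => ENNReal.ofReal_toReal (hut y)]
  rw [cost_eq_shiftCost_sub hM (x, φ x), hweq,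
    EReal.coe_ennreal_toReal (hut x)]
  simp only [sub_eq_add_neg, add_right_comm _ (-(k : EReal))]
  exact add_le_add_left hx' _

end OptimalityInequality

section Statements

variable {X A : Type*} [MetricSpace X] [TopologicalSpace.SeparableSpace X]
  [MeasurableSpace X] [BorelSpace X] [StandardBorelSpace X]
  [MetricSpace A] [TopologicalSpace.SeparableSpace A]
  [MeasurableSpace A] [BorelSpace A] [StandardBorelSpace A]

/-- Corollary 3.4. If Assumption W* or Assumption S* holds, and there
is a sequence `α_n ↑ 1` such that Assumption B̲_{{α_n}} holds and
`(1-α_n) m_{α_n} → w̲`, then the ACOI holds: there are a deterministic policy `φ` and a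
nonnegative measurable `u : X → ℝ` with
`c(x,φ(x)) + ∫ u dq(·|x,φ(x)) ≤ w̲ + u(x)` for all `x`. -/
theorem statement3
    (M : MDP X A)
    (hWS : (AssumptionWi M ∧ AssumptionWii M) ∨ (AssumptionSi M ∧ AssumptionSii M))
    (a : ℕ → ℝ)
    (ha : ∀ n, a n ∈ Set.Ico (0 : ℝ) 1) (hamono : Monotone a)
    (hatend : Tendsto a atTop (𝓝 (1 : ℝ)))
    (hB1 : wStar M < ⊤)
    (hB2 : ∀ x, Filter.liminf (fun n => uDisc M (a n) x) atTop < ⊤)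
    (hconv : Tendsto (fun n : ℕ => ((1 - a n : ℝ) : EReal) * mDisc M (a n)) atTop
      (𝓝 (wLow M))) :
    ∃ (φ : X → A) (_ : Measurable φ) (u : X → ℝ),
      (∀ x, 0 ≤ u x) ∧ Measurable u
      ∧ ∀ x, M.c x (φ x)
          + ((∫⁻ y, ENNReal.ofReal (u y) ∂ (M.q (x, φ x)) : ℝ≥0∞) : EReal)
        ≤ wLow M + (u x : EReal) := by
  obtain ⟨K, hK⟩ := M.c_ne_bot
  have hM : ∀ x a, ((-(max (-K) 0) : ℝ) : EReal) ≤ M.c x a := fun x a =>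
    le_trans (by exact_mod_cast neg_le.1 (le_max_left (-K) 0)) (hK x a)
  have hk : 0 ≤ max (-K) 0 := le_max_right _ _
  rcases isEmpty_or_nonempty X with hX | ⟨⟨x₀⟩⟩
  · exact ⟨isEmptyElim, measurable_of_empty _, isEmptyElim, isEmptyElim, measurable_of_empty _,
      isEmptyElim⟩
  have hA : Nonempty A := by
    by_contra hA
    rw [not_nonempty_iff] at hA
    have : IsEmpty (Policy X A) := ⟨fun p => by
      have := (p.markov 0).isProbabilityMeasure (Fin.elim0, x₀)
      exact IsProbabilityMeasure.ne_zero _ (Measure.eq_zero_of_isEmpty (p.π 0 (Fin.elim0, x₀)))⟩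
    simp [wStar, avgOpt] at hB1
  by_cases hw : wLow M = ⊤
  · obtain ⟨a₀⟩ := hA
    exact ⟨fun _ => a₀, measurable_const, fun _ => 0, fun _ => le_rfl, measurable_const,
      fun x => by simp [hw]⟩
  rcases hWS with ⟨h1, h2⟩ | ⟨h1, h2⟩
  · exact (isValueClass_lowerSemicontinuous (kInfCompact_shiftCost hM h1) h2).exists_acoi hk hM ha
      hamono hatend hB2 hconv hw
  · exact (isValueClass_measurable (measurable_shiftCost M _) (sectionInfCompact_shiftCost hM h1)
      h2).exists_acoi hk hM ha hamono hatend hB2 hconv hw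

end Statements

end
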